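/- arXiv:0712.3069 — 10 statements merged into one kernel-verified Lean document; each statement's English description precedes it below -/
import Mathlib

section
/- Let M be a 2×2 integer matrix with determinant 1 and |trace M| > 2, and let L : ℝ² → ℝ² be the induced invertible linear map, with L^k denoting its k-th power for k ∈ ℤ. If v ∈ ℝ² is such that the set {‖L^k v‖ : k ∈ ℤ} is bounded, then v = 0. -/
/-- A bounded two-sided solution of the recurrence `u (k + 2) + u k = t • u (k + 1)` with
`|t| > 2` vanishes identically. -/
theorem eq_zero_of_bounded_of_recurrence {E : Type*} [NormedAddCommGroup E] [NormedSpace ℝ E]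
    {t : ℝ} (ht : 2 < |t|) {u : ℤ → E} (hu : ∀ k, u (k + 2) + u k = t • u (k + 1))
    (hb : BddAbove (Set.range fun k => ‖u k‖)) (k : ℤ) : u k = 0 := by
  have hle (k : ℤ) : ‖u k‖ ≤ ⨆ j, ‖u j‖ := le_ciSup hb k
  have hmul (k : ℤ) : |t| * ‖u k‖ ≤ 2 * ⨆ j, ‖u j‖ := by
    have h := hu (k - 1)
    rw [sub_add_cancel] at h
    calc |t| * ‖u k‖ = ‖u (k - 1 + 2) + u (k - 1)‖ := by rw [h, norm_smul, Real.norm_eq_abs]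
      _ ≤ ‖u (k - 1 + 2)‖ + ‖u (k - 1)‖ := norm_add_le _ _
      _ ≤ 2 * ⨆ j, ‖u j‖ := by linarith [hle (k - 1 + 2), hle (k - 1)]
  have htpos : 0 < |t| := by linarith
  have hsup : ⨆ j, ‖u j‖ ≤ (2 * ⨆ j, ‖u j‖) / |t| :=
    ciSup_le fun k => by rw [le_div_iff₀' htpos]; exact hmul k
  rw [le_div_iff₀' htpos] at hsup
  have hk := hle k
  rw [← norm_le_zero_iff]
  nlinarith [norm_nonneg (u k)]

/-- The Cayley–Hamilton relation for a `2 × 2` matrix of determinant `1`, applied to a vector. -/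
theorem Matrix.mulVec_mulVec_add_self_of_det_eq_one {R : Type*} [CommRing R]
    {A : Matrix (Fin 2) (Fin 2) R} (hA : A.det = 1) (x : Fin 2 → R) :
    A.mulVec (A.mulVec x) + x = A.trace • A.mulVec x := by
  rw [Matrix.det_fin_two] at hA
  ext i
  fin_cases i <;> simp [Matrix.trace_fin_two]
  · linear_combination (-x 0) * hA
  · linear_combination (-x 1) * hA

/-- No nonzero vector has a bounded orbit under a hyperbolic linear map of `ℝ²`
induced by an integer matrix with determinant 1 and |trace| > 2. -/
theorem eq_zero_of_bounded_orbit (M : Matrix (Fin 2) (Fin 2) ℤ)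
    (hdet : M.det = 1) (htr : |M.trace| > 2)
    (L : (Fin 2 → ℝ) ≃ₗ[ℝ] (Fin 2 → ℝ))
    (hL : ∀ x, L x = Matrix.toLin' (M.map ((↑) : ℤ → ℝ)) x)
    (v : Fin 2 → ℝ) (B : ℝ) (hB : ∀ k : ℤ, ‖(L ^ k) v‖ ≤ B) :
    v = 0 := by
  have hdet' : (M.map ((↑) : ℤ → ℝ)).det = 1 := by
    rw [Matrix.det_fin_two] at hdet ⊢
    simp only [Matrix.map_apply]
    exact_mod_cast hdet
  have htr' : 2 < |(M.map ((↑) : ℤ → ℝ)).trace| := by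
    rw [Matrix.trace_fin_two] at htr ⊢
    simp only [Matrix.map_apply]
    exact_mod_cast htr
  have hrec (k : ℤ) :
      (L ^ (k + 2)) v + (L ^ k) v = (M.map ((↑) : ℤ → ℝ)).trace • (L ^ (k + 1)) v := by
    have h₁ : (L ^ (k + 1)) v = L ((L ^ k) v) := by
      rw [add_comm, zpow_one_add, LinearEquiv.mul_apply]
    have h₂ : (L ^ (k + 2)) v = L (L ((L ^ k) v)) := by
      rw [← h₁, ← LinearEquiv.mul_apply, ← zpow_one_add]
      congr 2
      ring
    rw [h₁, h₂]
    simp only [hL, Matrix.toLin'_apply]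
    exact Matrix.mulVec_mulVec_add_self_of_det_eq_one hdet' _
  have hbdd : BddAbove (Set.range fun k : ℤ => ‖(L ^ k) v‖) := ⟨B, Set.forall_mem_range.2 hB⟩
  simpa using eq_zero_of_bounded_of_recurrence htr' hrec hbdd 0
end

section
/- Let X be a metric space, let λ > 1, and let A : X → X be a bijection such that dist(A x, A y) = λ · dist(x, y) for all x, y ∈ X. Let F : X → X be a map and C ≥ 0 a constant with dist(F x, A x) ≤ C for all x ∈ X. Then for every x ∈ X, the sequence k ↦ (A⁻¹)^[k](F^[k](x)) (the k-fold inverse of A applied to the k-th iterate of F at x) is a Cauchy sequence; in fact consecutive terms satisfy dist((A⁻¹)^[k+1](F^[k+1](x)), (A⁻¹)^[k](F^[k](x))) ≤ λ^{-(k+1)} · C. -/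
/-- The `k`-th iterate of the inverse of a `λ`-homothety scales distances by `λ⁻ᵏ`. -/
theorem dist_symm_iterate {X : Type*} [PseudoMetricSpace X] {lam : ℝ} (hlam : lam ≠ 0)
    (A : X ≃ X) (hA : ∀ x y, dist (A x) (A y) = lam * dist x y) (k : ℕ) (x y : X) :
    dist ((⇑A.symm)^[k] x) ((⇑A.symm)^[k] y) = lam⁻¹ ^ k * dist x y := by
  induction k with
  | zero => simp
  | succ k ih =>
    rw [Function.iterate_succ_apply', Function.iterate_succ_apply', pow_succ', mul_assoc, ← ih,
      eq_inv_mul_iff_mul_eq₀ hlam, ← hA, A.apply_symm_apply, A.apply_symm_apply]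


/-- If `A` is an expanding `λ`-homothety and `F` stays within distance `C` of `A`,
then `k ↦ A⁻ᵏ Fᵏ x` is Cauchy, with consecutive terms within `λ^{-(k+1)} C`. -/
theorem cauchySeq_inv_iterate {X : Type*} [MetricSpace X] (lam : ℝ) (hlam : 1 < lam)
    (A : X ≃ X) (hA : ∀ x y, dist (A x) (A y) = lam * dist x y)
    (F : X → X) (C : ℝ) (hC : 0 ≤ C) (hF : ∀ x, dist (F x) (A x) ≤ C)
    (x : X) :
    CauchySeq (fun k => (⇑A.symm)^[k] (F^[k] x)) ∧
      ∀ k : ℕ, dist ((⇑A.symm)^[k + 1] (F^[k + 1] x)) ((⇑A.symm)^[k] (F^[k] x)) ≤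
        lam ^ (-((k : ℤ) + 1)) * C := by
  have hlam0 : 0 < lam := zero_lt_one.trans hlam
  have step (k : ℕ) :
      dist ((⇑A.symm)^[k + 1] (F^[k + 1] x)) ((⇑A.symm)^[k] (F^[k] x)) ≤
        lam⁻¹ ^ (k + 1) * C := by
    have key : (⇑A.symm)^[k] (F^[k] x) = (⇑A.symm)^[k + 1] (A (F^[k] x)) := by
      rw [Function.iterate_succ_apply, A.symm_apply_apply]
    rw [key, dist_symm_iterate hlam0.ne' A hA, Function.iterate_succ_apply']
    gcongr
    exact hF _
  refine ⟨cauchySeq_of_le_geometric lam⁻¹ (lam⁻¹ * C) (inv_lt_one_of_one_lt₀ hlam) fun k => ?_,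
    fun k => ?_⟩
  · rw [dist_comm]
    exact (step k).trans_eq (by ring)
  · refine (step k).trans_eq ?_
    rw [zpow_neg, inv_pow]
    norm_cast
end

section
/- Let X be a complete metric space, let λ > 1, and let A : X → X be a bijection such that dist(A x, A y) = λ · dist(x, y) for all x, y ∈ X. Let F : X → X be a continuous map and C ≥ 0 a constant with dist(F x, A x) ≤ C for all x ∈ X. Then there exists a continuous map θ : X → X such that θ ∘ F = A ∘ θ and dist(θ(x), x) ≤ C/(λ − 1) for all x ∈ X. -/
open Filter Topology

/-- The inverse of a `lam`-homothety is a `lam⁻¹`-homothety. -/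
theorem dist_symm_of_homothety {X : Type*} [PseudoMetricSpace X] {lam : ℝ} (hlam : lam ≠ 0)
    (A : X ≃ X) (hA : ∀ x y, dist (A x) (A y) = lam * dist x y) (x y : X) :
    dist (A.symm x) (A.symm y) = lam⁻¹ * dist x y := by
  have h := hA (A.symm x) (A.symm y)
  rw [A.apply_symm_apply, A.apply_symm_apply] at h
  rw [h, inv_mul_cancel_left₀ hlam]

/-- Consecutive terms of the sequence `A⁻ⁿ ∘ Fⁿ` are geometrically close. -/
theorem dist_symm_iterate_iterate_succ_le {X : Type*} [PseudoMetricSpace X] {lam : ℝ}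
    (hlam : 0 < lam) (A : X ≃ X) (hA : ∀ x y, dist (A x) (A y) = lam * dist x y)
    (F : X → X) {C : ℝ} (hF : ∀ x, dist (F x) (A x) ≤ C) (n : ℕ) (x : X) :
    dist (A.symm^[n] (F^[n] x)) (A.symm^[n + 1] (F^[n + 1] x)) ≤ C * lam⁻¹ * lam⁻¹ ^ n := by
  have hsymm := dist_symm_of_homothety hlam.ne' A hA
  induction n generalizing x with
  | zero =>
    have h := hsymm (A x) (F x)
    rw [A.symm_apply_apply, dist_comm (A x)] at h
    simp only [Function.iterate_zero, id_eq, zero_add, Function.iterate_one, pow_zero, mul_one]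
    rw [h, mul_comm C]
    exact mul_le_mul_of_nonneg_left (hF x) (inv_nonneg.2 hlam.le)
  | succ n ih =>
    rw [Function.iterate_succ_apply' A.symm n, Function.iterate_succ_apply' A.symm (n + 1),
      Function.iterate_succ_apply F n, Function.iterate_succ_apply F (n + 1), hsymm,
      pow_succ' lam⁻¹ n, mul_left_comm]
    exact mul_le_mul_of_nonneg_left (ih (F x)) (inv_nonneg.2 hlam.le)

/-- Existence of a continuous semiconjugacy from `F` to an expanding homothety `A`
on a complete metric space, within distance `C/(λ-1)` of the identity. -/
theorem semiconjugacy_to_homothety {X : Type*} [MetricSpace X] [CompleteSpace X]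
    (lam : ℝ) (hlam : 1 < lam)
    (A : X ≃ X) (hA : ∀ x y, dist (A x) (A y) = lam * dist x y)
    (F : X → X) (hFcont : Continuous F)
    (C : ℝ) (hC : 0 ≤ C) (hF : ∀ x, dist (F x) (A x) ≤ C) :
    ∃ θ : X → X, Continuous θ ∧ θ ∘ F = ⇑A ∘ θ ∧
      ∀ x, dist (θ x) x ≤ C / (lam - 1) := by
  have hpos : 0 < lam := one_pos.trans hlam
  have hr : lam⁻¹ < 1 := inv_lt_one_of_one_lt₀ hlam
  have hsymm := dist_symm_of_homothety hpos.ne' A hA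
  have hAcont : Continuous A.symm :=
    (LipschitzWith.of_dist_le_mul (K := ⟨lam⁻¹, inv_nonneg.2 hpos.le⟩)
      fun x y => (hsymm x y).le).continuous
  let u : ℕ → X → X := fun n x => A.symm^[n] (F^[n] x)
  have hu (x : X) (n : ℕ) : dist (u n x) (u (n + 1) x) ≤ C * lam⁻¹ * lam⁻¹ ^ n :=
    dist_symm_iterate_iterate_succ_le hpos A hA F hF n x
  choose θ hθ using fun x =>
    cauchySeq_tendsto_of_complete (cauchySeq_of_le_geometric _ _ hr (hu x))
  have hunif : TendstoUniformly u θ atTop := by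
    have hlim : Tendsto (fun n : ℕ => C * lam⁻¹ * lam⁻¹ ^ n / (1 - lam⁻¹)) atTop (𝓝 0) := by
      simpa using ((tendsto_pow_atTop_nhds_zero_of_lt_one (inv_nonneg.2 hpos.le) hr).const_mul
        (C * lam⁻¹)).div_const (1 - lam⁻¹)
    refine Metric.tendstoUniformly_iff.2 fun ε hε => ?_
    filter_upwards [hlim.eventually_lt_const hε] with n hn x
    rw [dist_comm]
    exact (dist_le_of_le_geometric_of_tendsto _ _ hr (hu x) (hθ x) n).trans_lt hn
  refine ⟨θ, hunif.continuous (Frequently.of_forall fun n =>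
    (hAcont.iterate n).comp (hFcont.iterate n)), funext fun x => ?_, fun x => ?_⟩
  · have hstep : Tendsto (fun n => u (n + 1) x) atTop (𝓝 (A.symm (θ (F x)))) := by
      simpa only [u, Function.iterate_succ_apply' A.symm, Function.iterate_succ_apply F,
        Function.comp_def] using (hAcont.tendsto _).comp (hθ (F x))
    exact A.symm_apply_eq.1 (tendsto_nhds_unique hstep ((tendsto_add_atTop_iff_nat 1).2 (hθ x)))
  · have h := dist_le_of_le_geometric_of_tendsto₀ _ _ hr (hu x) (hθ x)
    have hC' : C * lam⁻¹ / (1 - lam⁻¹) = C / (lam - 1) := by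
      rw [← mul_div_mul_right (C * lam⁻¹) (1 - lam⁻¹) hpos.ne', sub_mul, mul_assoc,
        inv_mul_cancel₀ hpos.ne', mul_one, one_mul]
    rw [dist_comm, ← hC']
    exact h
end

section
/- Let X be a complete metric space, let λ > 1, and let A : X → X be a bijection such that dist(A x, A y) = λ · dist(x, y) for all x, y ∈ X. Let F : X → X be a map and C ≥ 0 a constant with dist(F x, A x) ≤ C for all x ∈ X. Then for every x ∈ X there exists a unique point c ∈ X such that sup_{k ≥ 0} dist(A^[k](c), F^[k](x)) < ∞ (where A^[k] and F^[k] denote k-fold iterates). -/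
theorem dist_iterate_eq_pow_mul {X : Type*} [PseudoMetricSpace X] {lam : ℝ} {f : X → X}
    (hf : ∀ x y, dist (f x) (f y) = lam * dist x y) (n : ℕ) (x y : X) :
    dist (f^[n] x) (f^[n] y) = lam ^ n * dist x y := by
  induction n with
  | zero => simp
  | succ n ih => rw [Function.iterate_succ_apply', Function.iterate_succ_apply', hf, ih]; ring

/-- Two orbits of an expanding homothety that stay a bounded distance apart coincide. -/
theorem eq_of_dist_iterate_le {X : Type*} [MetricSpace X] {lam : ℝ} (hlam : 1 < lam) {f : X → X}
    (hf : ∀ x y, dist (f x) (f y) = lam * dist x y) {x y : X} {B : ℝ}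
    (hB : ∀ k : ℕ, dist (f^[k] x) (f^[k] y) ≤ B) : x = y := by
  by_contra hne
  have hpos : 0 < dist x y := dist_pos.2 hne
  obtain ⟨n, hn⟩ := pow_unbounded_of_one_lt (B / dist x y) hlam
  rw [div_lt_iff₀ hpos, ← dist_iterate_eq_pow_mul hf] at hn
  exact (hB n).not_gt hn

/-- For an expanding homothety `A` and a map `F` within distance `C` of `A`,
every `F`-orbit is shadowed by a unique `A`-orbit. -/
theorem exists_unique_shadowing {X : Type*} [MetricSpace X] [CompleteSpace X]
    (lam : ℝ) (hlam : 1 < lam)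
    (A : X ≃ X) (hA : ∀ x y, dist (A x) (A y) = lam * dist x y)
    (F : X → X) (C : ℝ) (hC : 0 ≤ C) (hF : ∀ x, dist (F x) (A x) ≤ C)
    (x : X) :
    ∃! c : X, ∃ B : ℝ, ∀ k : ℕ, dist ((⇑A)^[k] c) (F^[k] x) ≤ B := by
  have hpos : 0 < lam := zero_lt_one.trans hlam
  let u : ℕ → X := fun n => (⇑A.symm)^[n] (F^[n] x)
  have hu (n : ℕ) : (⇑A)^[n] (u n) = F^[n] x :=
    (Function.LeftInverse.iterate A.apply_symm_apply n) _
  have hstep (n : ℕ) : dist (u n) (u (n + 1)) ≤ C / lam * lam⁻¹ ^ n := by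
    have h := dist_iterate_eq_pow_mul hA (n + 1) (u n) (u (n + 1))
    rw [hu, Function.iterate_succ_apply', hu, Function.iterate_succ_apply', dist_comm] at h
    have h' := h ▸ hF (F^[n] x)
    rw [inv_pow, ← div_eq_mul_inv, div_div, ← pow_succ', le_div_iff₀' (pow_pos hpos _)]
    exact h'
  have hr : lam⁻¹ < 1 := inv_lt_one_of_one_lt₀ hlam
  obtain ⟨c, hc⟩ := cauchySeq_tendsto_of_complete (cauchySeq_of_le_geometric _ _ hr hstep)
  have hshadow (k : ℕ) : dist ((⇑A)^[k] c) (F^[k] x) ≤ C / lam / (1 - lam⁻¹) := by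
    have h := dist_le_of_le_geometric_of_tendsto _ _ hr hstep hc k
    rw [← hu k, dist_iterate_eq_pow_mul hA, dist_comm]
    calc lam ^ k * dist (u k) c
        ≤ lam ^ k * (C / lam * lam⁻¹ ^ k / (1 - lam⁻¹)) := by gcongr
      _ = (lam * lam⁻¹) ^ k * (C / lam / (1 - lam⁻¹)) := by rw [mul_pow]; ring
      _ = C / lam / (1 - lam⁻¹) := by rw [mul_inv_cancel₀ hpos.ne', one_pow, one_mul]
  refine ⟨c, ⟨_, hshadow⟩, ?_⟩
  rintro d ⟨B, hB⟩
  exact eq_of_dist_iterate_le hlam hA fun k =>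
    (dist_triangle_right _ _ (F^[k] x)).trans (add_le_add (hB k) (hshadow k))
end

section
/- Let X be a metric space, let λ > 1, and let A : X → X be a bijection such that dist(A x, A y) = λ · dist(x, y) for all x, y ∈ X. Let F : X → X and θ : X → X be maps with θ ∘ F = A ∘ θ and sup_{x ∈ X} dist(θ(x), x) < ∞. Let T : X → X be an isometry (dist(T x, T y) = dist(x, y) for all x, y) satisfying T ∘ A = A ∘ T and T ∘ F = F ∘ T. Then θ ∘ T = T ∘ θ. -/
/-- A bounded real function that is scaled by a factor `lam > 1` along a self-map is nonpositive. -/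
theorem nonpos_of_bounded_of_scaled {X : Type*} {lam B : ℝ} (hlam : 1 < lam) {F : X → X}
    {d : X → ℝ} (hB : ∀ x, d x ≤ B) (hF : ∀ x, d (F x) = lam * d x) (x : X) : d x ≤ 0 := by
  have iter : ∀ n : ℕ, d (F^[n] x) = lam ^ n * d x := by
    intro n
    induction n with
    | zero => simp
    | succ n ih => rw [Function.iterate_succ_apply', hF, ih, pow_succ]; ring
  by_contra! hpos
  obtain ⟨n, hn⟩ := pow_unbounded_of_one_lt (B / d x) hlam
  rw [div_lt_iff₀ hpos, ← iter n] at hn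
  exact (hB _).not_gt hn

/-- The bounded semiconjugacy `θ` to an expanding homothety is equivariant with
respect to any isometry `T` commuting with both `A` and `F`. -/
theorem semiconjugacy_equivariant {X : Type*} [MetricSpace X]
    (lam : ℝ) (hlam : 1 < lam)
    (A : X ≃ X) (hA : ∀ x y, dist (A x) (A y) = lam * dist x y)
    (F θ : X → X) (hθF : θ ∘ F = ⇑A ∘ θ)
    (C : ℝ) (hθb : ∀ x, dist (θ x) x ≤ C)
    (T : X → X) (hT : ∀ x y, dist (T x) (T y) = dist x y)
    (hTA : T ∘ ⇑A = ⇑A ∘ T) (hTF : T ∘ F = F ∘ T) :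
    θ ∘ T = T ∘ θ := by
  have hθF' : ∀ x, θ (F x) = A (θ x) := congrFun hθF
  have hTA' : ∀ x, T (A x) = A (T x) := congrFun hTA
  have hTF' : ∀ x, T (F x) = F (T x) := congrFun hTF
  funext x
  refine dist_le_zero.1 (nonpos_of_bounded_of_scaled (B := C + C) (F := F)
    (d := fun x => dist (θ (T x)) (T (θ x))) hlam (fun y => ?_) (fun y => ?_) x)
  · calc dist (θ (T y)) (T (θ y)) ≤ dist (θ (T y)) (T y) + dist (T (θ y)) (T y) :=
          dist_triangle_right _ _ _
      _ ≤ C + C := add_le_add (hθb _) ((hT _ _).trans_le (hθb y))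
  · simp only [hTF', hθF', hTA', hA]
end

section
/- Let X be a metric space, let λ > 1, and let A : X → X be a bijection such that dist(A x, A y) = λ · dist(x, y) for all x, y ∈ X. Let F : X → X and θ : X → X be maps with θ ∘ F = A ∘ θ and sup_{x ∈ X} dist(θ(x), x) < ∞. Let G : X → X be a map with G ∘ F = F ∘ G and sup_{x ∈ X} dist(G(x), x) < ∞. Then θ ∘ G = θ. -/
/-- Two semiconjugacies from `F` to an expanding homothety which are at bounded distance
from each other coincide. -/
theorem eq_of_semiconj_of_dist_le {X Y : Type*} [MetricSpace Y]
    {r K : ℝ} (hr : 1 < r) {A : Y → Y} (hA : ∀ x y, dist (A x) (A y) = r * dist x y)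
    {F : X → X} {φ ψ : X → Y} (hφ : Function.Semiconj φ F A) (hψ : Function.Semiconj ψ F A)
    (hK : ∀ x, dist (φ x) (ψ x) ≤ K) : φ = ψ := by
  have hiter : ∀ (n : ℕ) (x : X), r ^ n * dist (φ x) (ψ x) ≤ K := by
    intro n
    induction n with
    | zero => simpa using hK
    | succ n ih =>
      intro x
      have h := ih (F x)
      rwa [hφ.eq, hψ.eq, hA, ← mul_assoc, ← pow_succ] at h
  funext x
  by_contra hne
  have hpos : 0 < dist (φ x) (ψ x) := dist_pos.2 hne
  obtain ⟨n, hn⟩ := pow_unbounded_of_one_lt (K / dist (φ x) (ψ x)) hr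
  exact absurd (hiter n x) (not_le.2 ((div_lt_iff₀ hpos).1 hn))

/-- If `G` commutes with `F` and moves points a uniformly bounded distance, then
composing the bounded semiconjugacy `θ` with `G` does not change it. -/
theorem semiconjugacy_comp_eq {X : Type*} [MetricSpace X]
    (lam : ℝ) (hlam : 1 < lam)
    (A : X ≃ X) (hA : ∀ x y, dist (A x) (A y) = lam * dist x y)
    (F θ : X → X) (hθF : θ ∘ F = ⇑A ∘ θ)
    (C : ℝ) (hθb : ∀ x, dist (θ x) x ≤ C)
    (G : X → X) (hGF : G ∘ F = F ∘ G)
    (C' : ℝ) (hGb : ∀ x, dist (G x) x ≤ C') :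
    θ ∘ G = θ := by
  have hθ : Function.Semiconj θ F A := congrFun hθF
  have hG : Function.Semiconj G F F := congrFun hGF
  refine eq_of_semiconj_of_dist_le (K := C + C' + C) hlam hA (hθ.comp_left hG) hθ fun x => ?_
  calc dist (θ (G x)) (θ x) ≤ dist (θ (G x)) (G x) + dist (G x) x + dist x (θ x) :=
        dist_triangle4 _ _ _ _
    _ ≤ C + C' + C := by
        gcongr
        · exact hθb _
        · exact hGb x
        · exact dist_comm x (θ x) ▸ hθb x
end

section
/- Let L be a metric space, let λ > 1, and let A : L → L be a map such that dist(A a, A b) = λ · dist(a, b) for all a, b ∈ L. Let X be a set, F : X → X, Q : X → L and θ : X → L maps, and let C₂ ≥ 0 and C ≥ C₂ be constants such that dist(Q(F x), A(Q x)) ≤ C₂, dist(Q(x), θ(x)) ≤ C₂, and θ(F x) = A(θ x) for all x ∈ X. Fix c ∈ L and ε > 0, and for each natural number k define X_k = {x ∈ X : dist(Q(F^[k](x)), A^[k](c)) < λ^k · ε − C}. Then ⋃_{k ≥ 0} X_k = {x ∈ X : dist(θ(x), c) < ε}. -/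
/-- Iterating a homothety of ratio `r` multiplies distances by the powers of `r`. -/
theorem dist_iterate_of_dist_eq_mul {L : Type*} [PseudoMetricSpace L] {r : ℝ} {A : L → L}
    (hA : ∀ a b, dist (A a) (A b) = r * dist a b) (k : ℕ) (a b : L) :
    dist (A^[k] a) (A^[k] b) = r ^ k * dist a b := by
  induction k with
  | zero => simp
  | succ k ih => rw [Function.iterate_succ_apply', Function.iterate_succ_apply', hA, ih]; ring

/-- The set `V(c,ε) = θ⁻¹(N_ε(c))` is the increasing union of the sets `X_k`. -/
theorem iUnion_Xk_eq {L : Type*} [MetricSpace L] (lam : ℝ) (hlam : 1 < lam)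
    (A : L → L) (hA : ∀ a b, dist (A a) (A b) = lam * dist a b)
    {X : Type*} (F : X → X) (Q θ : X → L)
    (C₂ C : ℝ) (hC₂ : 0 ≤ C₂) (hC : C₂ ≤ C)
    (hQF : ∀ x, dist (Q (F x)) (A (Q x)) ≤ C₂)
    (hQθ : ∀ x, dist (Q x) (θ x) ≤ C₂)
    (hθ : ∀ x, θ (F x) = A (θ x))
    (c : L) (ε : ℝ) (hε : 0 < ε) :
    (⋃ k : ℕ, {x : X | dist (Q (F^[k] x)) (A^[k] c) < lam ^ k * ε - C}) =
      {x : X | dist (θ x) c < ε} := by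
  ext x
  have key (k : ℕ) : dist (θ (F^[k] x)) (A^[k] c) = lam ^ k * dist (θ x) c := by
    have hsemi : Function.Semiconj θ F A := hθ
    rw [(hsemi.iterate_right k).eq, dist_iterate_of_dist_eq_mul hA]
  simp only [Set.mem_iUnion, Set.mem_ofPred_eq]
  constructor
  · rintro ⟨k, hk⟩
    have htri := dist_triangle_left (θ (F^[k] x)) (A^[k] c) (Q (F^[k] x))
    have hlt : lam ^ k * dist (θ x) c < lam ^ k * ε := by
      linarith [key k, hQθ (F^[k] x)]
    exact lt_of_mul_lt_mul_left hlt (by positivity)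
  · intro hx
    have hpos : 0 < ε - dist (θ x) c := sub_pos.mpr hx
    obtain ⟨k, hk⟩ := pow_unbounded_of_one_lt ((C + C₂) / (ε - dist (θ x) c)) hlam
    rw [div_lt_iff₀ hpos] at hk
    have htri := dist_triangle (Q (F^[k] x)) (θ (F^[k] x)) (A^[k] c)
    exact ⟨k, by linarith [key k, hQθ (F^[k] x)]⟩
end

section
/- Let X be a topological space and let U : ℕ → Set X be a monotone sequence of subsets (U(k) ⊆ U(k+1) for all k) such that each U(k) is open and, as a topological subspace of X, is nonempty, path-connected and simply connected. Then the union ⋃_{k} U(k), as a topological subspace of X, is simply connected. -/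
/-- The union of a nonempty directed family of path-connected sets is path-connected. -/
theorem isPathConnected_iUnion_of_directed {X ι : Type*} [TopologicalSpace X] [Nonempty ι]
    {U : ι → Set X} (hU : Directed (· ⊆ ·) U) (hpath : ∀ i, IsPathConnected (U i)) :
    IsPathConnected (⋃ i, U i) := by
  rw [isPathConnected_iff]
  refine ⟨Set.nonempty_iUnion.2 ⟨Classical.arbitrary ι, (hpath _).nonempty⟩, fun x hx y hy => ?_⟩
  obtain ⟨i, hi⟩ := Set.mem_iUnion.1 hx
  obtain ⟨j, hj⟩ := Set.mem_iUnion.1 hy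
  obtain ⟨k, hik, hjk⟩ := hU i j
  exact ((hpath k).joinedIn x (hik hi) y (hjk hj)).mono (Set.subset_iUnion U k)

/-- The union of a nonempty directed family of open simply connected sets is simply connected. -/
theorem isSimplyConnected_iUnion_of_directed {X ι : Type*} [TopologicalSpace X] [Nonempty ι]
    {U : ι → Set X} (hU : Directed (· ⊆ ·) U) (hopen : ∀ i, IsOpen (U i))
    (hsc : ∀ i, IsSimplyConnected (U i)) : IsSimplyConnected (⋃ i, U i) := by
  refine isSimplyConnected_iff_exists_homotopy_refl_forall_mem.2
    ⟨isPathConnected_iUnion_of_directed hU fun i => (hsc i).isPathConnected, fun x p hp => ?_⟩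
  obtain ⟨k, hk⟩ := (isCompact_range p.continuous).elim_directed_cover U hopen
    (Set.range_subset_iff.2 hp) hU
  obtain ⟨F, hF⟩ := (isSimplyConnected_iff_exists_homotopy_refl_forall_mem.1 (hsc k)).2 x p
    (Set.range_subset_iff.1 hk)
  exact ⟨F, fun t => Set.mem_iUnion_of_mem k (hF t)⟩

/-- An increasing union of open, nonempty, path-connected, simply connected
subsets is simply connected. -/
theorem iUnion_simply_connected {X : Type*} [TopologicalSpace X]
    (U : ℕ → Set X) (hmono : ∀ k, U k ⊆ U (k + 1))
    (hopen : ∀ k, IsOpen (U k))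
    (hne : ∀ k, (U k).Nonempty)
    (hpath : ∀ k, PathConnectedSpace (U k))
    (hsc : ∀ k, SimplyConnectedSpace (U k)) :
    SimplyConnectedSpace (↥(⋃ k, U k)) := by
  exact isSimplyConnected_iUnion_of_directed (monotone_nat_of_le_succ hmono).directed_le hopen hsc
end

section
/- Let M be a 2×2 integer matrix with determinant 1 and |trace M| > 2, and let L : ℝ² → ℝ² be the induced invertible linear map. Let F : ℝ² → ℝ² be a homeomorphism with F(x + m) = F(x) + L(m) for all x ∈ ℝ² and m ∈ ℤ², let G : ℝ² → ℝ² be a homeomorphism with G(x + m) = G(x) + m for all x ∈ ℝ² and m ∈ ℤ² and with G ∘ F = F ∘ G, and let P : ℝ² → ℝ² be a continuous map with P ∘ F = L ∘ P and sup_{x ∈ ℝ²} ‖P(x) − x‖ < ∞. Then for every y ∈ ℝ², every connected component Λ of P⁻¹({y}) satisfies G(Λ) = Λ. -/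
open Set Filter Topology

theorem Real.mem_Ioo_of_forall_sin_pos {f : unitInterval → ℝ} (hf : Continuous f)
    (hsin : ∀ t, 0 < Real.sin (f t)) (s t : unitInterval) (h0 : f s ∈ Ioo 0 Real.pi) :
    f t ∈ Ioo 0 Real.pi := by
  have hpre : IsPreconnected (range f) := isPreconnected_range hf
  have hmem : ∀ c, Real.sin c = 0 → c ∉ range f := by
    rintro c hc ⟨u, rfl⟩
    exact (hsin u).ne' hc
  constructor
  · by_contra! h
    exact hmem 0 Real.sin_zero
      (hpre.ordConnected.out (mem_range_self t) (mem_range_self s) ⟨h, h0.1.le⟩)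
  · by_contra! h
    exact hmem _ Real.sin_pi
      (hpre.ordConnected.out (mem_range_self s) (mem_range_self t) ⟨h0.2.le, h⟩)

/-- A path crossing a rectangle vertically meets every path crossing it horizontally. -/
theorem exists_eq_of_crossing (α β : C(unitInterval, ℝ × ℝ))
    (hα0 : ∀ t, (α 0).2 < (β t).2) (hα1 : ∀ t, (β t).2 < (α 1).2)
    (hβ0 : ∀ s, (β 0).1 < (α s).1) (hβ1 : ∀ s, (α s).1 < (β 1).1) :
    ∃ s t, α s = β t := by
  by_contra! hne
  let f : C(unitInterval × unitInterval, ℂ) :=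
    ⟨fun x => ⟨(α x.1).1 - (β x.2).1, (α x.1).2 - (β x.2).2⟩, by
      have : Continuous fun x : unitInterval × unitInterval =>
        Complex.equivRealProdCLM.symm (α x.1 - β x.2) := by fun_prop
      exact this⟩
  have hf0 : ∀ x, f x ∈ ({0}ᶜ : Set ℂ) := by
    intro x hx
    have hx' : f x = 0 := hx
    have h1 := congrArg Complex.re hx'
    have h2 := congrArg Complex.im hx'
    exact hne x.1 x.2 (Prod.ext (sub_eq_zero.1 h1) (sub_eq_zero.1 h2))
  have : ContractibleSpace unitInterval := (convex_Icc (0 : ℝ) 1).contractibleSpace ⟨0, by simp⟩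
  have : LocallyPathConnectedSpace unitInterval := (convex_Icc (0 : ℝ) 1).locallyPathConnectedSpace
  obtain ⟨g, ⟨hg0, hg⟩, -⟩ := Complex.isCoveringMapOn_exp.existsUnique_continuousMap_lifts f
    (a₀ := (0, 0)) (Complex.exp_log (hf0 (0, 0))) hf0
  have hre : ∀ x, Real.exp (g x).re * Real.cos (g x).im = (α x.1).1 - (β x.2).1 := fun x => by
    rw [← Complex.exp_re]; exact congrArg Complex.re (congrFun hg x)
  have him : ∀ x, Real.exp (g x).re * Real.sin (g x).im = (α x.1).2 - (β x.2).2 := fun x => by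
    rw [← Complex.exp_im]; exact congrArg Complex.im (congrFun hg x)
  have hcorner : |(g (0, 0)).im| < Real.pi / 2 := by
    rw [hg0, Complex.log_im, Complex.abs_arg_lt_pi_div_two_iff]
    exact Or.inl (sub_pos.2 (hβ0 0))
  rw [abs_lt] at hcorner
  have hbottom : ∀ s, 0 < Real.cos (g (s, 0)).im := fun s =>
    pos_of_mul_pos_right (by rw [hre]; exact sub_pos.2 (hβ0 s)) (Real.exp_pos _).le
  have htop : ∀ s, Real.cos (g (s, 1)).im < 0 := fun s =>
    neg_of_mul_neg_right (by rw [hre]; exact sub_neg.2 (hβ1 s)) (Real.exp_pos _).le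
  have hleft : ∀ t, Real.sin (g (0, t)).im < 0 := fun t =>
    neg_of_mul_neg_right (by rw [him]; exact sub_neg.2 (hα0 t)) (Real.exp_pos _).le
  have hright : ∀ t, 0 < Real.sin (g (1, t)).im := fun t =>
    pos_of_mul_pos_right (by rw [him]; exact sub_pos.2 (hα1 t)) (Real.exp_pos _).le
  have h1 := Real.mem_Ioo_of_forall_sin_pos (f := fun s => (g (s, 0)).im + Real.pi / 2)
    (by fun_prop) (fun s => by rw [Real.sin_add_pi_div_two]; exact hbottom s) 0 1
    ⟨by linarith, by linarith⟩
  have h2 := Real.mem_Ioo_of_forall_sin_pos (f := fun t => (g (1, t)).im)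
    (by fun_prop) hright 0 1
    ⟨by
      by_contra! h
      exact (hright 0).not_ge (Real.sin_nonpos_of_nonpos_of_neg_pi_le h
        (by linarith [h1.1, Real.pi_pos])), by linarith [h1.2, Real.pi_pos]⟩
  have h3 := Real.mem_Ioo_of_forall_sin_pos (f := fun s => (g (s, 1)).im - Real.pi / 2)
    (by fun_prop) (fun s => by rw [Real.sin_sub_pi_div_two]; linarith [htop s]) 1 0
    ⟨by
      by_contra! h
      exact (htop 1).not_ge (Real.cos_nonneg_of_mem_Icc
        ⟨by linarith [h2.1, Real.pi_pos], by linarith⟩), by linarith [h2.2, Real.pi_pos]⟩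
  have h4 := Real.mem_Ioo_of_forall_sin_pos (f := fun t => (g (0, t)).im - Real.pi)
    (by fun_prop) (fun t => by rw [Real.sin_sub_pi]; linarith [hleft t]) 1 0
    ⟨by
      by_contra! h
      exact (hleft 1).not_ge (Real.sin_nonneg_of_nonneg_of_le_pi
        (by linarith [h3.1, Real.pi_pos]) (by linarith)), by linarith [h3.2, Real.pi_pos]⟩
  linarith [h4.1, Real.pi_pos]

/-- If `A` is periodic under `G` and disjoint from its image, then the part of `Y` reachable from the
invariant set `L` without meeting `A` meets the image of `A`. -/
theorem Homeomorph.exists_mem_connectedComponentIn_diff {X : Type*} [TopologicalSpace X]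
    [LocallyConnectedSpace X] (G : X ≃ₜ X) {Y A L : Set X} (hYo : IsOpen Y) (hY : IsPreconnected Y)
    (hGY : G '' Y = Y) (hL : IsPreconnected L) (hLY : L ⊆ Y) (hGL : G '' L = L)
    (hA : IsClosed A) (hAL : Disjoint A L) (hAY : (A ∩ Y).Nonempty) (hGA : Disjoint A (G '' A))
    {k : ℕ} (hk : 0 < k) (hGk : (Set.image G)^[k] A = A) {l : X} (hl : l ∈ L) :
    (connectedComponentIn (Y \ A) l ∩ G '' A).Nonempty := by
  by_contra hemp
  have hlA : ∀ B, Disjoint B L → L ⊆ Y \ B := fun B hB =>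
    subset_sdiff.2 ⟨hLY, hB.symm⟩
  have hGl : G l ∈ L := hGL ▸ mem_image_of_mem G hl
  -- `G` maps the component of `L` off `B` to the component of `L` off `G '' B`.
  have hstep : ∀ B, Disjoint B L →
      G '' connectedComponentIn (Y \ B) l = connectedComponentIn (Y \ G '' B) l := by
    intro B hB
    have hGB : Disjoint (G '' B) L := by
      rw [← hGL]; exact (disjoint_image_iff G.injective).2 hB
    rw [G.image_connectedComponentIn (hlA B hB hl), image_sdiff G.injective, hGY]
    exact (connectedComponentIn_eq
      (hL.subset_connectedComponentIn hl (hlA _ hGB) hGl)).symm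
  set D := connectedComponentIn (Y \ A) l with hD
  have hiter : ∀ n, Disjoint ((Set.image G)^[n] A) L ∧
      (Set.image G)^[n] D = connectedComponentIn (Y \ (Set.image G)^[n] A) l := by
    intro n
    induction n with
    | zero => exact ⟨hAL, rfl⟩
    | succ n ih =>
      simp only [Function.iterate_succ_apply']
      refine ⟨?_, by rw [ih.2, hstep _ ih.1]⟩
      rw [← hGL]; exact (disjoint_image_iff G.injective).2 ih.1
  have hsub : D ⊆ G '' D := by
    rw [hD, hstep A hAL]
    refine isPreconnected_connectedComponentIn.subset_connectedComponentIn
      (mem_connectedComponentIn (hlA A hAL hl)) fun x hx => ⟨?_, fun hx' => hemp ⟨x, hx, hx'⟩⟩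
    exact (connectedComponentIn_subset _ _ hx).1
  have hmono : ∀ n, D ⊆ (Set.image G)^[n] D := by
    intro n
    induction n with
    | zero => exact subset_rfl
    | succ n ih =>
      rw [Function.iterate_succ_apply']
      exact hsub.trans (image_mono ih)
  have hDeq : G '' D = D := by
    refine subset_antisymm ?_ hsub
    obtain ⟨n, rfl⟩ := Nat.exists_eq_succ_of_ne_zero hk.ne'
    refine (image_mono (hmono n)).trans ?_
    rw [← Function.iterate_succ_apply' (Set.image G), (hiter _).2, hGk]
  have hDA : connectedComponentIn (Y \ G '' A) l = D := by rw [← hstep A hAL, hDeq]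
  have hopen : ∀ B, IsClosed B → IsOpen (connectedComponentIn (Y \ B) l) := fun B hB =>
    (hYo.sdiff hB).connectedComponentIn
  -- A frontier point of `D` in `Y` lies in both `A` and `G '' A`.
  have hfr : ∀ z ∈ Y, z ∈ closure D → ∀ B, IsClosed B →
      connectedComponentIn (Y \ B) l = D → z ∉ B → z ∈ D := by
    intro z hzY hz B hB hBD hzB
    have hn : connectedComponentIn (Y \ B) z ∈ 𝓝 z :=
      connectedComponentIn_mem_nhds ((hYo.sdiff hB).mem_nhds ⟨hzY, hzB⟩)
    obtain ⟨w, hw1, hw2⟩ := mem_closure_iff_nhds.1 hz _ hn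
    rw [← hBD] at hw2 ⊢
    rw [connectedComponentIn_eq hw2, ← connectedComponentIn_eq hw1]
    exact mem_connectedComponentIn ⟨hzY, hzB⟩
  have hclosed : closure D ∩ Y ⊆ D := by
    rintro z ⟨hz, hzY⟩
    by_cases hzA : z ∈ A
    · exact hfr z hzY hz _ (G.isClosed_image.2 hA) hDA fun h => disjoint_left.1 hGA hzA h
    · exact hfr z hzY hz A hA rfl hzA
  have hYD : Y ⊆ D := hY.subset_of_closure_inter_subset (hopen A hA)
    ⟨l, hLY hl, mem_connectedComponentIn (hlA A hAL hl)⟩ hclosed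
  obtain ⟨a, haA, haY⟩ := hAY
  exact (connectedComponentIn_subset _ _ (hYD haY)).2 haA

theorem Homeomorph.image_preimage_of_forall_apply_eq {X Y : Type*} [TopologicalSpace X]
    {Φ : X → Y} {G : X ≃ₜ X} (hG : ∀ z, Φ (G z) = Φ z) (s : Set Y) :
    G '' (Φ ⁻¹' s) = Φ ⁻¹' s := by
  rw [← G.preimage_symm]
  ext z
  simp [← hG (G.symm z)]

/-- If `G` preserves the fibers of `Φ` and `U` is periodic and disjoint from its image, then the
image of `U` can be reached from the preimage of `s` inside that of `t` without meeting `U`. -/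
theorem exists_isOpen_isPreconnected_inter_nonempty {X Y : Type*} [TopologicalSpace X]
    [LocallyConnectedSpace X] [TopologicalSpace Y] {Φ : X → Y} (hΦ : Continuous Φ) {G : X ≃ₜ X}
    (hG : ∀ z, Φ (G z) = Φ z) {U : Set X} {k : ℕ} (hk : 0 < k)
    (hGk : (Set.image G)^[k] U = U) (hdisj : Disjoint (closure U) (G '' closure U))
    {s t : Set Y} (ht : IsOpen t) (htc : IsPreconnected (Φ ⁻¹' t))
    (hsc : IsPreconnected (Φ ⁻¹' s)) (hst : s ⊆ t) (hs : (Φ ⁻¹' s).Nonempty)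
    (hUs : Disjoint (closure U) (Φ ⁻¹' s)) (hUt : (U ∩ Φ ⁻¹' t).Nonempty) :
    ∃ Q, IsOpen Q ∧ IsPreconnected Q ∧ Φ ⁻¹' s ⊆ Q ∧ Q ⊆ Φ ⁻¹' t \ closure U ∧
      (Q ∩ G '' U).Nonempty := by
  obtain ⟨l, hl⟩ := hs
  have hclosure : ∀ n, (Set.image G)^[n] (closure U) = closure ((Set.image G)^[n] U) := by
    intro n
    induction n with
    | zero => rfl
    | succ n ih => rw [Function.iterate_succ_apply', Function.iterate_succ_apply', ih,
        G.image_closure]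
  have hopen : IsOpen (connectedComponentIn (Φ ⁻¹' t \ closure U) l) :=
    ((ht.preimage hΦ).sdiff isClosed_closure).connectedComponentIn
  refine ⟨_, hopen, isPreconnected_connectedComponentIn,
    hsc.subset_connectedComponentIn hl (subset_sdiff.2 ⟨preimage_mono hst, hUs.symm⟩),
    connectedComponentIn_subset _ _, ?_⟩
  have h := G.exists_mem_connectedComponentIn_diff (ht.preimage hΦ) htc
    (Homeomorph.image_preimage_of_forall_apply_eq hG t) hsc (preimage_mono hst)
    (Homeomorph.image_preimage_of_forall_apply_eq hG s) isClosed_closure hUs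
    (hUt.mono (inter_subset_inter_left _ subset_closure)) hdisj hk (by rw [hclosure, hGk]) hl
  rw [G.image_closure, inter_comm] at h
  rw [inter_comm]
  exact (closure_inter_open_nonempty_iff hopen).1 h

/-- `Φ` is a pair of functions at distance at most `C` from the coordinates `e` of the plane `X`,
such that the preimages of open strips parallel to the axes are connected. -/
structure MonotoneCoords {X : Type*} [TopologicalSpace X] (e : X ≃ₜ ℝ × ℝ) (Φ : X → ℝ × ℝ)
    (C : ℝ) : Prop where
  continuous : Continuous Φ
  fst_sub_le : ∀ z, |(Φ z).1 - (e z).1| ≤ C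
  snd_sub_le : ∀ z, |(Φ z).2 - (e z).2| ≤ C
  fst_isPreconnected : ∀ a b, IsPreconnected (Φ ⁻¹' {v | v.1 ∈ Ioo a b})
  snd_isPreconnected : ∀ a b, IsPreconnected (Φ ⁻¹' {v | v.2 ∈ Ioo a b})

namespace MonotoneCoords

variable {X : Type*} [TopologicalSpace X] {e : X ≃ₜ ℝ × ℝ} {Φ : X → ℝ × ℝ} {C : ℝ}

theorem swap (h : MonotoneCoords e Φ C) :
    MonotoneCoords (e.trans (Homeomorph.prodComm ℝ ℝ)) (fun z => (Φ z).swap) C where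
  continuous := continuous_swap.comp h.continuous
  fst_sub_le := h.snd_sub_le
  snd_sub_le := h.fst_sub_le
  fst_isPreconnected := h.snd_isPreconnected
  snd_isPreconnected := h.fst_isPreconnected

theorem fst_Iio_isPreconnected (h : MonotoneCoords e Φ C) (c : ℝ) :
    IsPreconnected (Φ ⁻¹' {v | v.1 < c}) := by
  refine isPreconnected_of_forall_pair fun x hx y hy => ?_
  refine ⟨Φ ⁻¹' {v | v.1 ∈ Ioo (min (Φ x).1 (Φ y).1 - 1) c}, fun z hz => hz.2,
    ⟨?_, hx⟩, ⟨?_, hy⟩, h.fst_isPreconnected (min (Φ x).1 (Φ y).1 - 1) c⟩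
  · linarith [min_le_left (Φ x).1 (Φ y).1]
  · linarith [min_le_right (Φ x).1 (Φ y).1]

theorem fst_Ioi_isPreconnected (h : MonotoneCoords e Φ C) (c : ℝ) :
    IsPreconnected (Φ ⁻¹' {v | c < v.1}) := by
  refine isPreconnected_of_forall_pair fun x hx y hy => ?_
  refine ⟨Φ ⁻¹' {v | v.1 ∈ Ioo c (max (Φ x).1 (Φ y).1 + 1)}, fun z hz => hz.1,
    ⟨hx, ?_⟩, ⟨hy, ?_⟩, h.fst_isPreconnected c (max (Φ x).1 (Φ y).1 + 1)⟩
  · linarith [le_max_left (Φ x).1 (Φ y).1]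
  · linarith [le_max_right (Φ x).1 (Φ y).1]

theorem exists_fst_eq (h : MonotoneCoords e Φ C) (c y : ℝ) :
    ∃ z, (Φ z).1 = c ∧ (e z).2 = y := by
  have hf : Continuous fun x => (Φ (e.symm (x, y))).1 :=
    (h.continuous.comp (e.symm.continuous.comp (by fun_prop))).fst
  have hb := fun x => abs_le.1 (h.fst_sub_le (e.symm (x, y)))
  simp only [e.apply_symm_apply] at hb
  obtain ⟨x, hx⟩ := mem_range_of_exists_le_of_exists_ge hf
    ⟨c - C, by linarith [(hb (c - C)).2]⟩ (⟨c + C, by linarith [(hb (c + C)).1]⟩ : ∃ x, c ≤ _)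
  exact ⟨_, hx, by simp⟩

theorem isCompact_preimage_closedBall (h : MonotoneCoords e Φ C) (v : ℝ × ℝ) (r : ℝ) :
    IsCompact (Φ ⁻¹' Metric.closedBall v r) := by
  have hK : IsCompact (e ⁻¹' Metric.closedBall v (r + C)) :=
    e.isCompact_preimage.2 (isCompact_closedBall _ _)
  refine hK.of_isClosed_subset (Metric.isClosed_closedBall.preimage h.continuous) fun z hz => ?_
  have hz' := dist_triangle (e z) (Φ z) v
  have hd : dist (e z) (Φ z) ≤ C := by
    rw [dist_comm, Prod.dist_eq, Real.dist_eq, Real.dist_eq]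
    exact max_le (h.fst_sub_le z) (h.snd_sub_le z)
  have : dist (Φ z) v ≤ r := hz
  exact Metric.mem_closedBall.2 (by linarith)

/-- Two disjoint translates of a connected set would both have to bridge a vertical strip,
while being reachable from both of its ends. -/
theorem false_of_disjoint_closure_image [LocallyPathConnectedSpace X] (h : MonotoneCoords e Φ C)
    {G : X ≃ₜ X} (hG : ∀ z, Φ (G z) = Φ z) {U : Set X} (hU : IsOpen U) (hUc : IsPreconnected U)
    {B : ℝ} (hB : ∀ z ∈ U, |(Φ z).1| ≤ B ∧ |(Φ z).2| ≤ B) {k : ℕ} (hk : 0 < k)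
    (hGk : (Set.image G)^[k] U = U) (hdisj : Disjoint (closure U) (G '' closure U))
    {u v : X} (hu : u ∈ U) (hv : v ∈ U) (huv : (Φ u).1 < (Φ v).1) : False := by
  have hC : 0 ≤ C := (abs_nonneg _).trans (h.fst_sub_le u)
  have hG' : ∀ z, Φ (G.symm z) = Φ z := fun z => by rw [← hG, G.apply_symm_apply]
  set U' := G '' U with hU'def
  have hU'o : IsOpen U' := G.isOpen_image.2 hU
  have hU'c : IsPreconnected U' := G.isPreconnected_image.2 hUc
  have hUU' : G.symm '' U' = U := by simp [hU'def, ← image_comp]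
  have hGk' : (Set.image G.symm)^[k] U' = U' := by
    have hinv : Function.LeftInverse (Set.image G.symm) (Set.image G) := fun s => by
      simp [← image_comp]
    have hU'k : (Set.image G)^[k] U' = U' := by
      rw [hU'def, ← Function.iterate_succ_apply, Function.iterate_succ_apply', hGk]
    conv_lhs => rw [← hU'k]
    exact hinv.iterate k U'
  have hdisj' : Disjoint (closure U') (G.symm '' closure U') := by
    rw [G.symm.image_closure, hUU', hU'def, ← G.image_closure]
    exact hdisj.symm
  have hBcl : ∀ z ∈ closure U, |(Φ z).1| ≤ B ∧ |(Φ z).2| ≤ B := by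
    have := h.continuous
    have h1 : IsClosed {z | |(Φ z).1| ≤ B} := isClosed_le (by fun_prop) (by fun_prop)
    have h2 : IsClosed {z | |(Φ z).2| ≤ B} := isClosed_le (by fun_prop) (by fun_prop)
    exact closure_minimal hB (h1.inter h2)
  have hBcl' : ∀ z ∈ closure U', |(Φ z).1| ≤ B ∧ |(Φ z).2| ≤ B := by
    rw [hU'def, ← G.image_closure]
    rintro _ ⟨z, hz, rfl⟩
    rw [hG]
    exact hBcl z hz
  have hB0 : 0 ≤ B := (abs_nonneg _).trans (hB u hu).1
  obtain ⟨c₁, hc₁, hc₁'⟩ := exists_between huv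
  obtain ⟨c₃, hc₃, hc₃'⟩ := exists_between hc₁'
  have hBu := abs_le.1 (hB u hu).1
  have hBv := abs_le.1 (hB v hv).1
  have hfst := fun z => abs_le.1 (h.fst_sub_le z)
  have hsnd := fun z => abs_le.1 (h.snd_sub_le z)
  have hU'mem : ∀ z ∈ U, G z ∈ U' := fun z hz => mem_image_of_mem G hz
  set K := B + C + 2 with hK
  -- the vertical crossing
  obtain ⟨Q₁, hQ₁o, hQ₁c, hQ₁s, hQ₁t, hQ₁U⟩ := exists_isOpen_isPreconnected_inter_nonempty
    h.continuous hG' hk hGk' hdisj' (s := {v | v.1 < -(B + 1)}) (t := {v | v.1 < c₁})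
    (isOpen_lt (by fun_prop) (by fun_prop)) (h.fst_Iio_isPreconnected _)
    (h.fst_Iio_isPreconnected _) (fun v (hv : v.1 < _) => by simp only [mem_ofPred_eq]; linarith)
    (by
      obtain ⟨z, hz, -⟩ := h.exists_fst_eq (-(B + 2)) 0
      exact ⟨z, by simp only [mem_preimage, mem_ofPred_eq, hz]; linarith⟩)
    (disjoint_left.2 fun z hz (hz' : (Φ z).1 < _) => by
      linarith [(abs_le.1 (hBcl' z hz).1).1])
    ⟨G u, hU'mem u hu, by simpa [hG] using hc₁⟩
  obtain ⟨Q₃, hQ₃o, hQ₃c, hQ₃s, hQ₃t, hQ₃U⟩ := exists_isOpen_isPreconnected_inter_nonempty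
    h.continuous hG' hk hGk' hdisj' (s := {v | B + 1 < v.1}) (t := {v | c₃ < v.1})
    (isOpen_lt (by fun_prop) (by fun_prop)) (h.fst_Ioi_isPreconnected _)
    (h.fst_Ioi_isPreconnected _) (fun v (hv : _ < v.1) => by simp only [mem_ofPred_eq]; linarith)
    (by
      obtain ⟨z, hz, -⟩ := h.exists_fst_eq (B + 2) 0
      exact ⟨z, by simp only [mem_preimage, mem_ofPred_eq, hz]; linarith⟩)
    (disjoint_left.2 fun z hz (hz' : _ < (Φ z).1) => by
      linarith [(abs_le.1 (hBcl' z hz).1).2])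
    ⟨G v, hU'mem v hv, by simpa [hG] using hc₃'⟩
  rw [hUU'] at hQ₁U hQ₃U
  have hV : IsPathConnected (Q₁ ∪ U ∪ Q₃) :=
    ((hQ₁o.union hU).union hQ₃o).isConnected_iff_isPathConnected.1
      ⟨⟨u, Or.inl (Or.inr hu)⟩, (hQ₁c.union' hQ₁U hUc).union'
        ((inter_comm _ _ ▸ hQ₃U).mono (inter_subset_inter_left _ subset_union_right)) hQ₃c⟩
  have hb₀ : e.symm (-K, 0) ∈ Q₁ := hQ₁s (by
    have := (hfst (e.symm (-K, 0))).2
    simp only [e.apply_symm_apply] at this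
    simp only [mem_preimage, mem_ofPred_eq]; linarith)
  have hb₁ : e.symm (K, 0) ∈ Q₃ := hQ₃s (by
    have := (hfst (e.symm (K, 0))).1
    simp only [e.apply_symm_apply] at this
    simp only [mem_preimage, mem_ofPred_eq]; linarith)
  obtain ⟨γ, hγ⟩ := hV.joinedIn _ (Or.inl (Or.inl hb₀)) _ (Or.inr hb₁)
  obtain ⟨M₀, hM₀⟩ : ∃ M₀, ∀ t, |(Φ (γ t)).2| ≤ M₀ := by
    have := h.continuous
    obtain ⟨M₀, hM₀⟩ := (isCompact_range (f := fun t => |(Φ (γ t)).2|) (by fun_prop)).bddAbove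
    exact ⟨M₀, fun t => hM₀ (mem_range_self t)⟩
  obtain ⟨M, hM₀M, hCM, hBM⟩ : ∃ M, M₀ < M ∧ C < M ∧ B < M :=
    ⟨max M₀ (max C B) + 1, by linarith [le_max_left M₀ (max C B)],
      by linarith [le_max_right M₀ (max C B), le_max_left C B],
      by linarith [le_max_right M₀ (max C B), le_max_right C B]⟩
  -- the horizontal crossing
  obtain ⟨w, hwU, hw⟩ : ∃ w ∈ U, (Φ w).1 ∈ Ioo c₁ c₃ := by
    obtain ⟨c₂, hc₂, hc₂'⟩ := exists_between hc₃
    obtain ⟨w, hwU, hw⟩ := hUc.intermediate_value hu hv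
      (f := fun z => (Φ z).1) (h.continuous.fst.continuousOn)
      (show c₂ ∈ Icc _ _ from ⟨by linarith, by linarith⟩)
    exact ⟨w, hwU, by simpa only [hw] using ⟨hc₂, hc₂'⟩⟩
  have hstrip : ∀ y, ∃ z, (Φ z).1 ∈ Ioo c₁ c₃ ∧ (e z).2 = y := fun y => by
    obtain ⟨z, hz, hz'⟩ := h.exists_fst_eq (Φ w).1 y
    exact ⟨z, hz.symm ▸ hw, hz'⟩
  obtain ⟨R₁, hR₁o, hR₁c, hR₁s, hR₁t, hR₁U⟩ := exists_isOpen_isPreconnected_inter_nonempty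
    h.continuous hG hk hGk hdisj (s := {v | v.2 < -M})
    (t := {v | v.1 ∈ Ioo c₁ c₃} ∪ {v | v.2 < -M})
    ((isOpen_Ioo.preimage continuous_fst).union (isOpen_lt (by fun_prop) (by fun_prop)))
    (by
      obtain ⟨z, hz, hz'⟩ := hstrip (-(M + C + 1))
      exact (h.fst_isPreconnected c₁ c₃).union z hz
        (show (Φ z).2 < -M by linarith [(hsnd z).2])
        (h.swap.fst_Iio_isPreconnected (-M)))
    (h.swap.fst_Iio_isPreconnected (-M)) subset_union_right
    (by
      obtain ⟨z, hz, hz'⟩ := hstrip (-(M + C + 1))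
      exact ⟨z, by simp only [mem_preimage, mem_ofPred_eq]; linarith [(hsnd z).2]⟩)
    (disjoint_left.2 fun z hz (hz' : (Φ z).2 < _) => by
      linarith [(abs_le.1 (hBcl z hz).2).1])
    ⟨w, hwU, Or.inl hw⟩
  obtain ⟨R₃, hR₃o, hR₃c, hR₃s, hR₃t, hR₃U⟩ := exists_isOpen_isPreconnected_inter_nonempty
    h.continuous hG hk hGk hdisj (s := {v | M < v.2})
    (t := {v | v.1 ∈ Ioo c₁ c₃} ∪ {v | M < v.2})
    ((isOpen_Ioo.preimage continuous_fst).union (isOpen_lt (by fun_prop) (by fun_prop)))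
    (by
      obtain ⟨z, hz, hz'⟩ := hstrip (M + C + 1)
      exact (h.fst_isPreconnected c₁ c₃).union z hz
        (show M < (Φ z).2 by linarith [(hsnd z).1])
        (h.swap.fst_Ioi_isPreconnected M))
    (h.swap.fst_Ioi_isPreconnected M) subset_union_right
    (by
      obtain ⟨z, hz, hz'⟩ := hstrip (M + C + 1)
      exact ⟨z, by simp only [mem_preimage, mem_ofPred_eq]; linarith [(hsnd z).1]⟩)
    (disjoint_left.2 fun z hz (hz' : _ < (Φ z).2) => by
      linarith [(abs_le.1 (hBcl z hz).2).2])
    ⟨w, hwU, Or.inl hw⟩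
  have hH : IsPathConnected (R₁ ∪ U' ∪ R₃) :=
    ((hR₁o.union hU'o).union hR₃o).isConnected_iff_isPathConnected.1
      ⟨⟨G u, Or.inl (Or.inr (hU'mem u hu))⟩, (hR₁c.union' hR₁U hU'c).union'
        ((inter_comm _ _ ▸ hR₃U).mono (inter_subset_inter_left _ subset_union_right)) hR₃c⟩
  have ha₀ : e.symm (0, -(M + C + 1)) ∈ R₁ := hR₁s (by
    have := (hsnd (e.symm (0, -(M + C + 1)))).2
    simp only [e.apply_symm_apply] at this
    simp only [mem_preimage, mem_ofPred_eq]; linarith)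
  have ha₁ : e.symm (0, M + C + 1) ∈ R₃ := hR₃s (by
    have := (hsnd (e.symm (0, M + C + 1))).1
    simp only [e.apply_symm_apply] at this
    simp only [mem_preimage, mem_ofPred_eq]; linarith)
  obtain ⟨δ, hδ⟩ := hH.joinedIn _ (Or.inl (Or.inl ha₀)) _ (Or.inr ha₁)
  obtain ⟨T, hKT, hT⟩ : ∃ T, K < T ∧ ∀ s, |(e (δ s)).1| < T := by
    obtain ⟨T, hT⟩ := (isCompact_range (f := fun t => |(e (δ t)).1|) (by fun_prop)).bddAbove
    exact ⟨max K T + 1, by linarith [le_max_left K T], fun s =>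
      by linarith [le_max_right K T, hT (mem_range_self s)]⟩
  -- extend the vertical crossing by two rays
  have hray : ∀ a b : ℝ, (∀ x ∈ uIcc a b, K ≤ |x|) →
      JoinedIn (range γ ∪ {z | (e z).2 = 0 ∧ K ≤ |(e z).1|}) (e.symm (a, 0)) (e.symm (b, 0)) := by
    intro a b hab
    have hJ : JoinedIn (uIcc a b) a b :=
      ((convex_uIcc a b).isPathConnected ⟨a, left_mem_uIcc⟩).joinedIn _ left_mem_uIcc _
        right_mem_uIcc
    refine (hJ.map (f := fun x => e.symm (x, 0)) (by fun_prop)).mono ?_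
    rintro _ ⟨x, hx, rfl⟩
    exact Or.inr ⟨by simp, by simpa using hab x hx⟩
  have hK0 : 0 < K := by linarith
  obtain ⟨ε, hε⟩ : JoinedIn (range γ ∪ {z | (e z).2 = 0 ∧ K ≤ |(e z).1|})
      (e.symm (-T, 0)) (e.symm (T, 0)) := by
    refine ((hray (-T) (-K) fun x hx => ?_).trans ⟨γ, fun t => Or.inl (mem_range_self t)⟩).trans
      (hray K T fun x hx => ?_)
    · rw [uIcc_of_le (by linarith)] at hx
      rw [abs_of_nonpos (by linarith [hx.2])]
      linarith [hx.2]
    · rw [uIcc_of_le (by linarith)] at hx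
      exact hx.1.trans (le_abs_self x)
  have hεsnd : ∀ t, |(e (ε t)).2| < M + C + 1 := by
    intro t
    rw [abs_lt]
    rcases hε t with ⟨t', ht'⟩ | ⟨ht', -⟩
    · rw [← ht']
      have := hsnd (γ t')
      have := abs_le.1 (hM₀ t')
      constructor <;> linarith
    · rw [ht']
      constructor <;> linarith
  obtain ⟨s, t, hst⟩ := exists_eq_of_crossing ⟨fun s => e (δ s), by fun_prop⟩
    ⟨fun t => e (ε t), by fun_prop⟩
    (fun t => by simpa using (abs_lt.1 (hεsnd t)).1)
    (fun t => by simpa using (abs_lt.1 (hεsnd t)).2)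
    (fun s => by simpa using (abs_lt.1 (hT s)).1) (fun s => by simpa using (abs_lt.1 (hT s)).2)
  have hst' : δ s = ε t := e.injective hst
  set z := δ s with hz
  -- the two crossings are disjoint
  have hzH : z ∈ U' ∨ (z ∉ closure U ∧ ((Φ z).1 ∈ Ioo c₁ c₃ ∨ M < |(Φ z).2|)) := by
    rcases hδ s with (hs | hs) | hs
    · refine Or.inr ⟨(hR₁t hs).2, (hR₁t hs).1.imp_right fun hs' => ?_⟩
      exact lt_abs.2 (Or.inr (by linarith [show (Φ z).2 < -M from hs']))
    · exact Or.inl hs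
    · refine Or.inr ⟨(hR₃t hs).2, (hR₃t hs).1.imp_right fun hs' => ?_⟩
      exact lt_abs.2 (Or.inl hs')
  have hzV := hε t
  rw [← hst'] at hzV
  rcases hzV with ⟨t', ht'⟩ | ⟨hz2, hz1⟩
  · have hzM := hM₀ t'
    rw [ht'] at hzM
    have hzV' := hγ t'
    rw [ht'] at hzV'
    have hQ : z ∈ U ∨ (z ∉ closure U' ∧ (Φ z).1 ∉ Ioo c₁ c₃) := by
      rcases hzV' with (hs | hs) | hs
      · exact Or.inr ⟨(hQ₁t hs).2, fun hs' => hs'.1.not_gt (hQ₁t hs).1⟩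
      · exact Or.inl hs
      · exact Or.inr ⟨(hQ₃t hs).2, fun hs' => hs'.2.not_gt (hQ₃t hs).1⟩
    rcases hzH with hzU' | ⟨hzU, hzS | hzM'⟩
    · rcases hQ with hzU | ⟨hzU, -⟩
      · refine disjoint_left.1 hdisj (subset_closure hzU) ?_
        rw [G.image_closure]
        exact subset_closure hzU'
      · exact hzU (subset_closure hzU')
    · rcases hQ with hzU' | ⟨-, hzS'⟩
      · exact hzU (subset_closure hzU')
      · exact hzS' hzS
    · linarith
  · have h2 := hsnd z
    have h1 : B + 2 ≤ |(Φ z).1| := by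
      have := abs_sub_abs_le_abs_sub (e z).1 (Φ z).1
      rw [abs_sub_comm] at this
      linarith [h.fst_sub_le z]
    rcases hzH with hzU' | ⟨-, hzS | hzM⟩
    · linarith [(hBcl' z (subset_closure hzU')).1]
    · have : |(Φ z).1| ≤ B := abs_le.2 ⟨by linarith [hzS.1], by linarith [hzS.2]⟩
      linarith
    · have : |(Φ z).2| ≤ C := by
        simpa [hz2] using h.snd_sub_le z
      linarith

end MonotoneCoords

theorem Homeomorph.iterate_image_connectedComponentIn {X : Type*} [TopologicalSpace X] {A : Set X}
    {G : X ≃ₜ X} (hA : G '' A = A) {z : X} (hz : z ∈ A) (n : ℕ) :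
    (Set.image G)^[n] (connectedComponentIn A z) = connectedComponentIn A (G^[n] z) := by
  induction n generalizing z with
  | zero => rfl
  | succ n ih =>
    rw [Function.iterate_succ_apply, Function.iterate_succ_apply,
      G.image_connectedComponentIn hz, hA, ih (hA ▸ mem_image_of_mem G hz)]

theorem Homeomorph.exists_iterate_image_connectedComponentIn_eq {X : Type*} [TopologicalSpace X]
    [LocallyConnectedSpace X] {A K : Set X} {G : X ≃ₜ X} (hA : G '' A = A) (hAo : IsOpen A)
    (hK : IsCompact K) (hKA : K ⊆ A) {z : X} (hz : ∀ n, G^[n] z ∈ K) :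
    ∃ k, 0 < k ∧ (Set.image G)^[k] (connectedComponentIn A z) = connectedComponentIn A z := by
  obtain ⟨w, hwK, hw⟩ := hK.exists_mapClusterPt_of_frequently (l := atTop) (f := fun n => G^[n] z)
    (Frequently.of_forall hz)
  have hfreq : ∃ᶠ n in atTop, G^[n] z ∈ connectedComponentIn A w :=
    hw.frequently (connectedComponentIn_mem_nhds (hAo.mem_nhds (hKA hwK)))
  rw [frequently_atTop] at hfreq
  obtain ⟨i, -, hi⟩ := hfreq 0
  obtain ⟨j, hij, hj⟩ := hfreq (i + 1)
  obtain ⟨k, rfl⟩ := Nat.exists_eq_add_of_le hij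
  have hzA : z ∈ A := hKA (hz 0)
  refine ⟨k + 1, k.succ_pos, ?_⟩
  refine G.injective.image_injective.iterate i ?_
  rw [← Function.iterate_add_apply, iterate_image_connectedComponentIn hA hzA,
    iterate_image_connectedComponentIn hA hzA, ← connectedComponentIn_eq hi,
    connectedComponentIn_eq hj, add_right_comm, add_assoc]

namespace MonotoneCoords

variable {X : Type*} [TopologicalSpace X] {e : X ≃ₜ ℝ × ℝ} {Φ : X → ℝ × ℝ} {C : ℝ}

/-- `G` preserves the components of the preimages of balls that meet the central fiber. -/
theorem apply_mem_connectedComponentIn_ball [LocallyPathConnectedSpace X]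
    (h : MonotoneCoords e Φ C) {G : X ≃ₜ X} (hG : ∀ z, Φ (G z) = Φ z) (z : X) {r : ℝ}
    (hr : 0 < r) : G z ∈ connectedComponentIn (Φ ⁻¹' Metric.ball (Φ z) r) z := by
  by_contra hGz
  set A := Φ ⁻¹' Metric.ball (Φ z) (r / 2)
  set U := connectedComponentIn A z with hU
  have hAo : IsOpen A := Metric.isOpen_ball.preimage h.continuous
  have hUo : IsOpen U := hAo.connectedComponentIn
  have hzA : z ∈ A := Metric.mem_ball_self (half_pos hr)
  have hzU : z ∈ U := mem_connectedComponentIn hzA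
  have hzV : z ∈ Φ ⁻¹' Metric.ball (Φ z) r := Metric.mem_ball_self hr
  have hUc : IsPreconnected U := isPreconnected_connectedComponentIn
  have hUb : ∀ x ∈ U, Φ x ∈ Metric.ball (Φ z) (r / 2) := connectedComponentIn_subset A z
  have hcl : closure U ⊆ connectedComponentIn (Φ ⁻¹' Metric.ball (Φ z) r) z := by
    refine hUc.closure.subset_connectedComponentIn (subset_closure hzU) ?_
    have hsub : U ⊆ Φ ⁻¹' Metric.closedBall (Φ z) (r / 2) := fun x hx =>
      Metric.ball_subset_closedBall (hUb x hx)
    exact (closure_minimal hsub (Metric.isClosed_closedBall.preimage h.continuous)).trans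
      (preimage_mono (Metric.closedBall_subset_ball (half_lt_self hr)))
  have hdisj : Disjoint (closure U) (G '' closure U) := by
    refine (?_ : Disjoint _ _).mono hcl (image_mono hcl)
    rw [G.image_connectedComponentIn hzV,
      Homeomorph.image_preimage_of_forall_apply_eq hG]
    refine disjoint_left.2 fun x hx hx' => hGz ?_
    rw [connectedComponentIn_eq hx, ← connectedComponentIn_eq hx']
    exact mem_connectedComponentIn (by rw [mem_preimage, hG]; exact hzV)
  obtain ⟨k, hk, hGk⟩ := Homeomorph.exists_iterate_image_connectedComponentIn_eq
    (Homeomorph.image_preimage_of_forall_apply_eq hG _) hAo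
    (h.isCompact_preimage_closedBall (Φ z) 0)
    (preimage_mono (Metric.closedBall_subset_ball (half_pos hr)))
    (z := z) fun n => by
      have : Φ (G^[n] z) = Φ z := by
        induction n with
        | zero => rfl
        | succ n ih => rw [Function.iterate_succ_apply', hG, ih]
      simp [this]
  obtain ⟨B, hB⟩ : ∃ B, ∀ x ∈ U, |(Φ x).1| ≤ B ∧ |(Φ x).2| ≤ B := by
    obtain ⟨B, hB⟩ := (Metric.isBounded_ball (x := Φ z) (r := r / 2)).exists_norm_le
    exact ⟨B, fun x hx =>
      ⟨(norm_fst_le (Φ x)).trans (hB _ (hUb x hx)), (norm_snd_le (Φ x)).trans (hB _ (hUb x hx))⟩⟩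
  have hfst : ∀ x ∈ U, ∀ x' ∈ U, (Φ x).1 = (Φ x').1 := fun x hx x' hx' => by
    by_contra hne
    rcases lt_or_gt_of_ne hne with hlt | hlt
    · exact h.false_of_disjoint_closure_image hG hUo hUc hB hk hGk hdisj hx hx' hlt
    · exact h.false_of_disjoint_closure_image hG hUo hUc hB hk hGk hdisj hx' hx hlt
  have hsnd : ∀ x ∈ U, ∀ x' ∈ U, (Φ x).2 = (Φ x').2 := fun x hx x' hx' => by
    by_contra hne
    have hG' : ∀ z, (Φ (G z)).swap = (Φ z).swap := fun z => by rw [hG]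
    have hB' : ∀ x ∈ U, |(Φ x).swap.1| ≤ B ∧ |(Φ x).swap.2| ≤ B := fun x hx => (hB x hx).symm
    rcases lt_or_gt_of_ne hne with hlt | hlt
    · exact h.swap.false_of_disjoint_closure_image hG' hUo hUc hB' hk hGk hdisj hx hx' hlt
    · exact h.swap.false_of_disjoint_closure_image hG' hUo hUc hB' hk hGk hdisj hx' hx hlt
  have hconst : closure U ⊆ A := by
    refine (closure_minimal (fun x hx => ?_) (isClosed_singleton.preimage h.continuous)).trans
      (preimage_mono (singleton_subset_iff.2 (Metric.mem_ball_self (half_pos hr))))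
    exact Prod.ext (hfst x hx z hzU) (hsnd x hx z hzU)
  have hclU : closure U ⊆ U :=
    hUc.closure.subset_connectedComponentIn (subset_closure hzU) hconst
  have : PreconnectedSpace X := e.symm.surjective.denseRange.preconnectedSpace e.symm.continuous
  have huniv : U = univ :=
    IsClopen.eq_univ ⟨isClosed_of_closure_subset hclU, hUo⟩ ⟨z, hzU⟩
  exact hGz (hcl (subset_closure (huniv ▸ mem_univ _)))

theorem image_connectedComponentIn_fiber [LocallyPathConnectedSpace X]
    (h : MonotoneCoords e Φ C) {G : X ≃ₜ X} (hG : ∀ z, Φ (G z) = Φ z) (z : X) :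
    G '' connectedComponentIn (Φ ⁻¹' {Φ z}) z = connectedComponentIn (Φ ⁻¹' {Φ z}) z := by
  have hz : z ∈ Φ ⁻¹' {Φ z} := rfl
  have hGz : G z ∈ Φ ⁻¹' {Φ z} := hG z
  rw [G.image_connectedComponentIn hz, Homeomorph.image_preimage_of_forall_apply_eq hG]
  refine (connectedComponentIn_eq ?_).symm
  have : T2Space X := e.symm.t2Space
  have hK : IsCompact (Φ ⁻¹' {Φ z}) := by
    simpa using h.isCompact_preimage_closedBall (Φ z) 0
  have : CompactSpace (Φ ⁻¹' {Φ z}) := isCompact_iff_compactSpace.1 hK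
  rw [connectedComponentIn_eq_image hz]
  refine ⟨⟨G z, hGz⟩, ?_, rfl⟩
  rw [connectedComponent_eq_iInter_isClopen]
  refine mem_iInter.2 fun ⟨s, hs, hzs⟩ => ?_
  by_contra hGzs
  obtain ⟨O₁, O₂, hO₁, hO₂, hs₁, hs₂, hO⟩ := SeparatedNhds.of_isCompact_isCompact
    (hs.1.isCompact.image continuous_subtype_val)
    (hs.compl.1.isCompact.image continuous_subtype_val)
    ((disjoint_image_iff Subtype.val_injective).2 disjoint_compl_right)
  have hsub : Φ ⁻¹' {Φ z} ⊆ O₁ ∪ O₂ := fun x hx => by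
    by_cases hxs : (⟨x, hx⟩ : Φ ⁻¹' {Φ z}) ∈ s
    · exact Or.inl (hs₁ ⟨_, hxs, rfl⟩)
    · exact Or.inr (hs₂ ⟨_, hxs, rfl⟩)
  obtain ⟨r, hr, hrO⟩ : ∃ r > 0, Φ ⁻¹' Metric.ball (Φ z) r ⊆ O₁ ∪ O₂ := by
    by_contra! hcon
    have hK' := (h.isCompact_preimage_closedBall (Φ z) 1).diff (hO₁.union hO₂)
    have himg := hK'.image h.continuous
    have hnot : (Φ '' (Φ ⁻¹' Metric.closedBall (Φ z) 1 \ (O₁ ∪ O₂)))ᶜ ∈ 𝓝 (Φ z) := by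
      refine himg.isClosed.isOpen_compl.mem_nhds ?_
      rintro ⟨x, hx, hxz⟩
      exact hx.2 (hsub hxz)
    obtain ⟨r, hr, hr'⟩ := Metric.mem_nhds_iff.1 hnot
    obtain ⟨x, hx, hxO⟩ := not_subset.1 (hcon (min r 1) (lt_min hr one_pos))
    refine hr' (Metric.ball_subset_ball (min_le_left r 1) hx) ⟨x, ⟨?_, hxO⟩, rfl⟩
    exact Metric.ball_subset_closedBall (Metric.ball_subset_ball (min_le_right r 1) hx)
  have hmem := h.apply_mem_connectedComponentIn_ball hG z hr
  have hz₁ : z ∈ O₁ := hs₁ ⟨_, hzs, rfl⟩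
  have hG₂ : G z ∈ O₂ := hs₂ ⟨_, hGzs, rfl⟩
  have hpre : connectedComponentIn (Φ ⁻¹' Metric.ball (Φ z) r) z ⊆ O₁ :=
    isPreconnected_connectedComponentIn.subset_left_of_subset_union hO₁ hO₂ hO
      ((connectedComponentIn_subset _ _).trans hrO)
      ⟨z, mem_connectedComponentIn (Metric.mem_ball_self hr), hz₁⟩
  exact disjoint_left.1 hO (hpre hmem) hG₂

end MonotoneCoords

theorem eq_zero_of_forall_apply_eq_mul {X : Type*} {F : X → X} {f : X → ℝ} {l B : ℝ}
    (hl : 1 < |l|) (hF : ∀ z, f (F z) = l * f z) (hB : ∀ z, |f z| ≤ B) (z : X) : f z = 0 := by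
  by_contra hz
  have hz' : 0 < |f z| := abs_pos.2 hz
  obtain ⟨n, hn⟩ := pow_unbounded_of_one_lt (B / |f z|) hl
  have hiter : f (F^[n] z) = l ^ n * f z := by
    clear hn
    induction n with
    | zero => simp
    | succ n ih => rw [Function.iterate_succ_apply', hF, ih]; ring
  have := hB (F^[n] z)
  rw [hiter, abs_mul, abs_pow] at this
  rw [div_lt_iff₀ hz'] at hn
  linarith

theorem isPreconnected_preimage_Ioo_of_forall_apply_eq_mul {X : Type*} [TopologicalSpace X]
    {F : X ≃ₜ X} {p r : X → ℝ} {l C : ℝ} (hl : 1 < |l|) (hF : ∀ z, p (F z) = l * p z)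
    (hpr : ∀ z, |p z - r z| ≤ C) (hr : ∀ a b, IsPreconnected (r ⁻¹' Ioo a b)) (a b : ℝ) :
    IsPreconnected (p ⁻¹' Ioo a b) := by
  refine isPreconnected_of_forall_pair fun x hx y hy => ?_
  obtain ⟨ε, hε, hεa, hεb⟩ : ∃ ε > 0, (a + 2 * ε ≤ p x ∧ a + 2 * ε ≤ p y) ∧
      (p x ≤ b - 2 * ε ∧ p y ≤ b - 2 * ε) := by
    obtain ⟨⟨hax, hxb⟩, hay, hyb⟩ : p x ∈ Ioo a b ∧ p y ∈ Ioo a b := ⟨hx, hy⟩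
    refine ⟨min (min (p x - a) (b - p x)) (min (p y - a) (b - p y)) / 2,
      half_pos (lt_min (lt_min (by linarith) (by linarith))
        (lt_min (by linarith) (by linarith))), ?_⟩
    have h1 := min_le_left (min (p x - a) (b - p x)) (min (p y - a) (b - p y))
    have h2 := min_le_right (min (p x - a) (b - p x)) (min (p y - a) (b - p y))
    have h3 := le_min_iff.1 h1
    have h4 := le_min_iff.1 h2
    exact ⟨⟨by linarith, by linarith⟩, by linarith, by linarith⟩
  have hl2 : 1 < l ^ 2 := (one_lt_sq_iff_one_lt_abs l).2 hl
  obtain ⟨n, hn⟩ := pow_unbounded_of_one_lt (C / ε) hl2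
  rw [div_lt_iff₀ hε, ← pow_mul] at hn
  have hN : 0 < l ^ (2 * n) := by rw [pow_mul]; positivity
  set N := l ^ (2 * n)
  have hiter : ∀ k z, p (F^[k] z) = l ^ k * p z := fun k z => by
    induction k with
    | zero => simp
    | succ k ih => rw [Function.iterate_succ_apply', hF, ih]; ring
  have hleft : Function.LeftInverse F.symm^[2 * n] F^[2 * n] :=
    Function.LeftInverse.iterate F.symm_apply_apply _
  have hright : Function.LeftInverse F^[2 * n] F.symm^[2 * n] :=
    Function.LeftInverse.iterate F.apply_symm_apply _
  have hmem : ∀ z, a + 2 * ε ≤ p z → p z ≤ b - 2 * ε →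
      z ∈ F.symm^[2 * n] '' (r ⁻¹' Ioo (N * (a + ε)) (N * (b - ε))) := by
    intro z hza hzb
    refine ⟨F^[2 * n] z, ?_, hleft z⟩
    have h1 := abs_le.1 (hpr (F^[2 * n] z))
    rw [hiter] at h1
    have h2 := mul_le_mul_of_nonneg_left hza hN.le
    have h3 := mul_le_mul_of_nonneg_left hzb hN.le
    constructor <;> nlinarith
  refine ⟨F.symm^[2 * n] '' (r ⁻¹' Ioo (N * (a + ε)) (N * (b - ε))), ?_,
    hmem x hεa.1 hεb.1, hmem y hεa.2 hεb.2,
    (hr _ _).image _ (F.symm.continuous.iterate _).continuousOn⟩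
  rintro _ ⟨z, ⟨hza, hzb⟩, rfl⟩
  have h1 := abs_le.1 (hpr z)
  have h2 := hiter (2 * n) (F.symm^[2 * n] z)
  rw [hright z] at h2
  exact ⟨lt_of_mul_lt_mul_left (by linarith) hN.le, lt_of_mul_lt_mul_left (by linarith) hN.le⟩

namespace MonotoneCoords

variable {X : Type*} [TopologicalSpace X] {e : X ≃ₜ ℝ × ℝ} {Φ : X → ℝ × ℝ} {C : ℝ}

theorem of_forall_apply_eq_mul (hΦ : Continuous Φ) (hfst : ∀ z, |(Φ z).1 - (e z).1| ≤ C)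
    (hsnd : ∀ z, |(Φ z).2 - (e z).2| ≤ C) {F : X ≃ₜ X} {l : ℝ} (hl : 1 < |l|)
    (hF : ∀ z, Φ (F z) = (l * (Φ z).1, l⁻¹ * (Φ z).2)) : MonotoneCoords e Φ C where
  continuous := hΦ
  fst_sub_le := hfst
  snd_sub_le := hsnd
  fst_isPreconnected := isPreconnected_preimage_Ioo_of_forall_apply_eq_mul
    (p := fun z => (Φ z).1) (r := fun z => (e z).1) hl (fun z => by rw [hF]) hfst fun a b => by
      have := e.isPreconnected_preimage.2
        ((isPreconnected_Ioo (a := a) (b := b)).prod (isPreconnected_univ (α := ℝ)))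
      rwa [prod_univ] at this
  snd_isPreconnected := isPreconnected_preimage_Ioo_of_forall_apply_eq_mul
    (F := F.symm) (p := fun z => (Φ z).2) (r := fun z => (e z).2) hl
    (fun z => by
      have hl0 : l ≠ 0 := by rintro rfl; norm_num at hl
      have := hF (F.symm z)
      rw [F.apply_symm_apply] at this
      rw [this, mul_inv_cancel_left₀ hl0]) hsnd fun a b => by
      have := e.isPreconnected_preimage.2
        ((isPreconnected_univ (α := ℝ)).prod (isPreconnected_Ioo (a := a) (b := b)))
      rwa [univ_prod] at this

theorem apply_eq_of_commute (h : MonotoneCoords e Φ C) {F G : X ≃ₜ X} {l D : ℝ} (hl : 1 < |l|)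
    (hF : ∀ z, Φ (F z) = (l * (Φ z).1, l⁻¹ * (Φ z).2)) (hGF : ∀ z, G (F z) = F (G z))
    (hG : ∀ z, ‖e (G z) - e z‖ ≤ D) (z : X) : Φ (G z) = Φ z := by
  have hl0 : l ≠ 0 := by rintro rfl; norm_num at hl
  have hFs : ∀ z, (Φ (F.symm z)).2 = l * (Φ z).2 := fun z => by
    have := hF (F.symm z)
    rw [F.apply_symm_apply] at this
    rw [this, mul_inv_cancel_left₀ hl0]
  have hGFs : ∀ z, G (F.symm z) = F.symm (G z) := fun z => by
    rw [F.eq_symm_apply, ← hGF, F.apply_symm_apply]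
  refine Prod.ext (sub_eq_zero.1 ?_) (sub_eq_zero.1 ?_)
  · refine eq_zero_of_forall_apply_eq_mul (F := F) (f := fun z => (Φ (G z)).1 - (Φ z).1)
      (B := 2 * C + D) hl (fun z => by simp only [hGF, hF]; ring) (fun z => ?_) z
    have h1 := abs_le.1 (h.fst_sub_le z)
    have h2 := abs_le.1 (h.fst_sub_le (G z))
    have h3 : |(e (G z)).1 - (e z).1| ≤ D := (norm_fst_le (e (G z) - e z)).trans (hG z)
    rw [abs_le] at h3 ⊢
    constructor <;> linarith
  · refine eq_zero_of_forall_apply_eq_mul (F := F.symm) (f := fun z => (Φ (G z)).2 - (Φ z).2)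
      (B := 2 * C + D) hl (fun z => by simp only [hGFs, hFs]; ring) (fun z => ?_) z
    have h1 := abs_le.1 (h.snd_sub_le z)
    have h2 := abs_le.1 (h.snd_sub_le (G z))
    have h3 : |(e (G z)).2 - (e z).2| ≤ D := (norm_snd_le (e (G z) - e z)).trans (hG z)
    rw [abs_le] at h3 ⊢
    constructor <;> linarith

end MonotoneCoords

theorem exists_one_lt_abs_add_inv_eq {t : ℝ} (ht : 2 < |t|) : ∃ l : ℝ, 1 < |l| ∧ l + l⁻¹ = t := by
  have h4 : 0 ≤ t ^ 2 - 4 := by nlinarith [sq_abs t]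
  have hs := Real.sq_sqrt h4
  have hs0 := Real.sqrt_nonneg (t ^ 2 - 4)
  set s := Real.sqrt (t ^ 2 - 4)
  obtain ⟨l, hl, hlt⟩ : ∃ l : ℝ, 1 < |l| ∧ l ^ 2 + 1 = t * l := by
    rcases lt_abs.1 ht with h | h
    · exact ⟨(t + s) / 2, lt_abs.2 (Or.inl (by linarith)), by linear_combination hs / 4⟩
    · exact ⟨(t - s) / 2, lt_abs.2 (Or.inr (by linarith)), by linear_combination hs / 4⟩
  have hl0 : l ≠ 0 := by rintro rfl; norm_num at hl
  exact ⟨l, hl, by field_simp; linarith⟩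

theorem Matrix.apply_one_zero_ne_zero_of_two_lt_abs_trace {M : Matrix (Fin 2) (Fin 2) ℤ}
    (hdet : M.det = 1) (htr : 2 < |M.trace|) : M 1 0 ≠ 0 := by
  intro hc
  rw [Matrix.det_fin_two, hc, mul_zero, sub_zero] at hdet
  rw [Matrix.trace_fin_two] at htr
  rcases Int.mul_eq_one_iff_eq_one_or_neg_one.1 hdet with ⟨h0, h1⟩ | ⟨h0, h1⟩ <;>
    norm_num [h0, h1] at htr

/-- Linear coordinates on the plane diagonalizing a hyperbolic integer matrix. -/
theorem Matrix.exists_continuousLinearEquiv_toLin' {M : Matrix (Fin 2) (Fin 2) ℤ}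
    (hdet : M.det = 1) (htr : 2 < |M.trace|) :
    ∃ (l : ℝ) (e : (Fin 2 → ℝ) ≃L[ℝ] ℝ × ℝ), 1 < |l| ∧
      ∀ v, e (Matrix.toLin' (M.map ((↑) : ℤ → ℝ)) v) = (l * (e v).1, l⁻¹ * (e v).2) := by
  have hc : (M 1 0 : ℝ) ≠ 0 :=
    Int.cast_ne_zero.2 (Matrix.apply_one_zero_ne_zero_of_two_lt_abs_trace hdet htr)
  obtain ⟨l, hl, hlt⟩ := exists_one_lt_abs_add_inv_eq (t := (M.trace : ℝ)) (by exact_mod_cast htr)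
  have hl0 : l ≠ 0 := by rintro rfl; norm_num at hl
  have hne : l - l⁻¹ ≠ 0 := sub_ne_zero.2 fun h => by
    have := inv_lt_one_of_one_lt₀ hl
    rw [← abs_inv, ← h] at this
    linarith
  have hdet' : (M 0 0 : ℝ) * M 1 1 - M 0 1 * M 1 0 = 1 := by
    rw [Matrix.det_fin_two] at hdet
    exact_mod_cast hdet
  have htr' : l + l⁻¹ = M 0 0 + M 1 1 := by
    rw [hlt, Matrix.trace_fin_two]
    push_cast
    rfl
  have hinv := mul_inv_cancel₀ hl0
  set m := l⁻¹
  let e : (Fin 2 → ℝ) ≃ₗ[ℝ] ℝ × ℝ :=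
    { toFun := fun v => (M 1 0 * v 0 + (l - M 0 0) * v 1, M 1 0 * v 0 + (m - M 0 0) * v 1)
      map_add' := fun v w => by ext <;> simp <;> ring
      map_smul' := fun k v => by ext <;> simp <;> ring
      invFun := fun p => ![(p.1 - (l - M 0 0) * ((p.1 - p.2) / (l - m))) / M 1 0,
        (p.1 - p.2) / (l - m)]
      left_inv := fun v => by
        ext i
        fin_cases i <;> simp <;> field_simp <;> ring
      right_inv := fun p => by
        ext <;> simp <;> field_simp <;> ring }
  refine ⟨l, e.toContinuousLinearEquiv, hl, fun v => ?_⟩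
  have he : ∀ v, e v = (M 1 0 * v 0 + (l - M 0 0) * v 1, M 1 0 * v 0 + (m - M 0 0) * v 1) :=
    fun v => rfl
  simp only [LinearEquiv.coe_toContinuousLinearEquiv', he, Matrix.toLin'_apply, Matrix.mulVec,
    dotProduct, Fin.sum_univ_two, Matrix.map_apply]
  refine Prod.ext ?_ ?_
  · linear_combination (-v 1) * hdet' + (-l * v 1) * htr' + v 1 * hinv
  · linear_combination (-v 1) * hdet' + (-m * v 1) * htr' + v 1 * hinv

theorem exists_norm_sub_le_of_forall_apply_add {ι : Type*} [Fintype ι] {G : (ι → ℝ) → (ι → ℝ)}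
    (hGc : Continuous G)
    (hG : ∀ (x : ι → ℝ) (m : ι → ℤ), G (x + fun i => (m i : ℝ)) = G x + fun i => (m i : ℝ)) :
    ∃ D, ∀ x, ‖G x - x‖ ≤ D := by
  obtain ⟨D, hD⟩ := (isCompact_Icc (a := (0 : ι → ℝ)) (b := 1)).exists_bound_of_continuousOn
    (f := fun x => G x - x) (by fun_prop)
  refine ⟨D, fun x => ?_⟩
  have hx : x = (fun i => Int.fract (x i)) + fun i => (⌊x i⌋ : ℝ) :=
    funext fun i => (Int.fract_add_floor (x i)).symm
  rw [hx, hG, add_sub_add_right_eq_sub]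
  exact hD _ ⟨fun i => Int.fract_nonneg _, fun i => (Int.fract_lt_one _).le⟩

/-- Markovich's theorem in the universal cover of the torus: each connected
component of a fiber of Franks' semiconjugacy `P` is invariant under the
identity lift `G` of a commuting homeomorphism isotopic to the identity. -/
theorem markovich_torus (M : Matrix (Fin 2) (Fin 2) ℤ)
    (hdet : M.det = 1) (htr : |M.trace| > 2)
    (L : (Fin 2 → ℝ) →ₗ[ℝ] (Fin 2 → ℝ))
    (hL : L = Matrix.toLin' (M.map ((↑) : ℤ → ℝ)))
    (F : (Fin 2 → ℝ) ≃ₜ (Fin 2 → ℝ))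
    (hF : ∀ (x : Fin 2 → ℝ) (m : Fin 2 → ℤ),
      F (x + fun i => (m i : ℝ)) = F x + L (fun i => (m i : ℝ)))
    (G : (Fin 2 → ℝ) ≃ₜ (Fin 2 → ℝ))
    (hG : ∀ (x : Fin 2 → ℝ) (m : Fin 2 → ℤ),
      G (x + fun i => (m i : ℝ)) = G x + fun i => (m i : ℝ))
    (hGF : ⇑G ∘ ⇑F = ⇑F ∘ ⇑G)
    (P : (Fin 2 → ℝ) → (Fin 2 → ℝ)) (hPc : Continuous P)
    (hP : P ∘ ⇑F = ⇑L ∘ P)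
    (C : ℝ) (hPb : ∀ x, ‖P x - x‖ ≤ C)
    (y : Fin 2 → ℝ) (x : Fin 2 → ℝ) (hx : x ∈ P ⁻¹' {y}) :
    ⇑G '' connectedComponentIn (P ⁻¹' {y}) x = connectedComponentIn (P ⁻¹' {y}) x := by
  obtain ⟨l, e, hl, he⟩ := Matrix.exists_continuousLinearEquiv_toLin' hdet htr
  obtain ⟨D, hD⟩ := exists_norm_sub_le_of_forall_apply_add G.continuous hG
  have hbound : ∀ {v w : Fin 2 → ℝ} {B : ℝ}, ‖v - w‖ ≤ B →
      ‖e v - e w‖ ≤ ‖(e : (Fin 2 → ℝ) →L[ℝ] ℝ × ℝ)‖ * B := fun {v w B} h => by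
    rw [← map_sub]
    exact (e : (Fin 2 → ℝ) →L[ℝ] ℝ × ℝ).le_opNorm_of_le h
  have hΦF : ∀ z, e (P (F z)) = (l * (e (P z)).1, l⁻¹ * (e (P z)).2) := fun z => by
    rw [← he, ← hL]
    exact congrArg e (congrFun hP z)
  have h := MonotoneCoords.of_forall_apply_eq_mul (e := e.toHomeomorph) (Φ := fun z => e (P z))
    (e.continuous.comp hPc)
    (fun z => (norm_fst_le (e (P z) - e z)).trans (hbound (hPb z)))
    (fun z => (norm_snd_le (e (P z) - e z)).trans (hbound (hPb z))) hl hΦF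
  have hΦG := h.apply_eq_of_commute hl hΦF (congrFun hGF) fun z => hbound (hD z)
  obtain rfl : P x = y := hx
  have hfiber : P ⁻¹' {P x} = (fun z => e (P z)) ⁻¹' {e (P x)} := by
    ext z
    simp
  rw [hfiber]
  exact h.image_connectedComponentIn_fiber hΦG x
end

section
/- Let M be a 2×2 integer matrix with determinant 1 and |trace M| > 2, and let L : ℝ² → ℝ² be the induced invertible linear map. Let F : ℝ² → ℝ² be a bijection, let G : ℝ² → ℝ² be a map with sup_{x ∈ ℝ²} ‖G(x) − x‖ < ∞ and G ∘ F = F ∘ G, and let P : ℝ² → ℝ² be a map with P ∘ F = L ∘ P and sup_{x ∈ ℝ²} ‖P(x) − x‖ < ∞. Then P ∘ G = P; in particular, every fiber P⁻¹({y}) is G-invariant. -/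
/-- Cayley–Hamilton for the action of a `2 × 2` integer matrix of determinant `1` on the plane. -/
lemma trace_smul_toLin'_of_det_eq_one (M : Matrix (Fin 2) (Fin 2) ℤ) (hdet : M.det = 1)
    (v : Fin 2 → ℝ) :
    (M.trace : ℝ) • Matrix.toLin' (M.map ((↑) : ℤ → ℝ)) v =
      Matrix.toLin' (M.map ((↑) : ℤ → ℝ)) (Matrix.toLin' (M.map ((↑) : ℤ → ℝ)) v) + v := by
  have hd : (M 0 0 : ℝ) * M 1 1 - M 0 1 * M 1 0 = 1 := by
    rw [Matrix.det_fin_two] at hdet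
    exact_mod_cast hdet
  ext i
  fin_cases i
  · simp [Matrix.trace_fin_two]
    linear_combination v 0 * hd
  · simp [Matrix.trace_fin_two]
    linear_combination v 1 * hd

/-- A bounded function satisfying `t • d (F x) = d (F (F x)) + d x` with `|t| > 2` and `F`
surjective vanishes. -/
lemma eq_zero_of_bounded_of_smul_eq_add {X E : Type*} [NormedAddCommGroup E] [NormedSpace ℝ E]
    {F : X → X} (hF : Function.Surjective F) {d : X → E} {C t : ℝ} (hC : ∀ x, ‖d x‖ ≤ C)
    (ht : 2 < |t|) (hd : ∀ x, t • d (F x) = d (F (F x)) + d x) (x : X) : d x = 0 := by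
  have : Nonempty X := ⟨x⟩
  have hle : ∀ y, ‖d y‖ ≤ ⨆ z, ‖d z‖ := le_ciSup ⟨C, Set.forall_mem_range.2 hC⟩
  have hS : ⨆ z, ‖d z‖ ≤ 2 * (⨆ z, ‖d z‖) / |t| := by
    refine ciSup_le fun y => ?_
    obtain ⟨w, rfl⟩ := hF y
    rw [le_div_iff₀ (by linarith), mul_comm, ← Real.norm_eq_abs, ← norm_smul, hd]
    linarith [norm_add_le (d (F (F w))) (d w), hle (F (F w)), hle w]
  rw [le_div_iff₀ (by linarith)] at hS
  have h0 := norm_nonneg (d x)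
  have hx := hle x
  exact norm_le_zero_iff.1 (by nlinarith)


/-- Torus case of `Θ ∘ G = Θ`: if `G` commutes with `F` and moves points a
bounded distance, then `P ∘ G = P`, so every fiber of `P` is `G`-invariant. -/
theorem semiconjugacy_comp_G_torus (M : Matrix (Fin 2) (Fin 2) ℤ)
    (hdet : M.det = 1) (htr : |M.trace| > 2)
    (L : (Fin 2 → ℝ) →ₗ[ℝ] (Fin 2 → ℝ))
    (hL : L = Matrix.toLin' (M.map ((↑) : ℤ → ℝ)))
    (F : (Fin 2 → ℝ) → (Fin 2 → ℝ)) (hFbij : Function.Bijective F)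
    (G : (Fin 2 → ℝ) → (Fin 2 → ℝ))
    (CG : ℝ) (hGb : ∀ x, ‖G x - x‖ ≤ CG)
    (hGF : G ∘ F = F ∘ G)
    (P : (Fin 2 → ℝ) → (Fin 2 → ℝ)) (hP : P ∘ F = ⇑L ∘ P)
    (CP : ℝ) (hPb : ∀ x, ‖P x - x‖ ≤ CP) :
    P ∘ G = P ∧ ∀ y, G '' (P ⁻¹' {y}) ⊆ P ⁻¹' {y} := by
  have hPF : ∀ x, P (F x) = L (P x) := congrFun hP
  have hG : ∀ x, G (F x) = F (G x) := congrFun hGF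
  have hdF : ∀ x, P (G (F x)) - P (F x) = L (P (G x) - P x) := fun x => by
    rw [hG, hPF, hPF, map_sub]
  have hbd : ∀ x, ‖P (G x) - P x‖ ≤ CP + CG + CP := fun x => by
    have h : P (G x) - P x = (P (G x) - G x) + (G x - x) - (P x - x) := by abel
    rw [h]
    linarith [norm_sub_le ((P (G x) - G x) + (G x - x)) (P x - x),
      norm_add_le (P (G x) - G x) (G x - x), hPb (G x), hGb x, hPb x]
  have ht : 2 < |(M.trace : ℝ)| := by exact_mod_cast htr
  have key : ∀ x, P (G x) = P x := fun x =>
    sub_eq_zero.1 <| eq_zero_of_bounded_of_smul_eq_add (d := fun x => P (G x) - P x)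
      hFbij.surjective hbd ht (fun y => by
        simp only [hdF]
        rw [hL]
        exact trace_smul_toLin'_of_det_eq_one M hdet _) x
  refine ⟨funext key, ?_⟩
  rintro y _ ⟨x, hx, rfl⟩
  exact (key x).trans hx
end
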